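/- arXiv:1909.03203 — 10 statements merged into one kernel-verified Lean document; each statement's English description precedes it below -/
import Mathlib

section
/- Let λ > 0 and let f : (0,1) → ℝ be a continuous function. Suppose that every λ-admissible line in ℝ² (i.e. every line that is vertical or whose slope μ satisfies |μ| ≥ λ) intersects the graph of f in at most two points. Then f is locally Lipschitz on (0,1). -/
/-- A continuous function with a positive, a negative, a positive and a negative value at four
successive points of an interval has three distinct zeros there. -/
theorem exists_three_zeros_of_alternating {g : ℝ → ℝ} {l p q r : ℝ} (hlp : l < p) (hpq : p < q)
    (hqr : q < r) (hg : ContinuousOn g (Set.Icc l r)) (hl : 0 < g l) (hp : g p < 0)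
    (hq : 0 < g q) (hr : g r < 0) :
    ∃ x ∈ Set.Icc l r, ∃ y ∈ Set.Icc l r, ∃ z ∈ Set.Icc l r,
      x < y ∧ y < z ∧ g x = 0 ∧ g y = 0 ∧ g z = 0 := by
  obtain ⟨x, hx, hgx⟩ := intermediate_value_Ioo' hlp.le
    (hg.mono (Set.Icc_subset_Icc le_rfl (by linarith))) ⟨hp, hl⟩
  obtain ⟨y, hy, hgy⟩ := intermediate_value_Ioo hpq.le
    (hg.mono (Set.Icc_subset_Icc hlp.le hqr.le)) ⟨hp, hq⟩
  obtain ⟨z, hz, hgz⟩ := intermediate_value_Ioo' hqr.le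
    (hg.mono (Set.Icc_subset_Icc (by linarith) le_rfl)) ⟨hr, hq⟩
  simp only [Set.mem_Ioo] at hx hy hz
  exact ⟨x, ⟨by linarith, by linarith⟩, y, ⟨by linarith, by linarith⟩,
    z, ⟨by linarith, by linarith⟩, by linarith, by linarith, hgx, hgy, hgz⟩

/-- If a continuous function is positive at the left endpoint, negative at the right endpoint and
has two zeros in between, then some value is attained at three distinct points. -/
theorem exists_three_points_same_value {g : ℝ → ℝ} {l a b r : ℝ} (hla : l < a) (hab : a < b)
    (hbr : b < r) (hg : ContinuousOn g (Set.Icc l r)) (hl : 0 < g l) (ha : g a = 0)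
    (hb : g b = 0) (hr : g r < 0) :
    ∃ c, ∃ x ∈ Set.Icc l r, ∃ y ∈ Set.Icc l r, ∃ z ∈ Set.Icc l r,
      x < y ∧ y < z ∧ g x = c ∧ g y = c ∧ g z = c := by
  obtain ⟨m, ham, hmb⟩ := exists_between hab
  rcases lt_trichotomy (g m) 0 with hm | hm | hm
  · obtain ⟨c, hc, hc0⟩ := exists_between (max_lt hm hr)
    obtain ⟨hmc, hrc⟩ := max_lt_iff.1 hc
    obtain ⟨x, hx, y, hy, z, hz, hxy, hyz, h₁, h₂, h₃⟩ :=
      exists_three_zeros_of_alternating (g := fun t => g t - c) (hla.trans ham) hmb hbr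
        (hg.sub continuousOn_const) (by linarith) (by linarith) (by linarith) (by linarith)
    exact ⟨c, x, hx, y, hy, z, hz, hxy, hyz, by linarith, by linarith, by linarith⟩
  · exact ⟨0, a, ⟨by linarith, by linarith⟩, m, ⟨by linarith, by linarith⟩,
      b, ⟨by linarith, by linarith⟩, ham, hmb, ha, hm, hb⟩
  · obtain ⟨c, hc0, hc⟩ := exists_between (lt_min hm hl)
    obtain ⟨hmc, hlc⟩ := lt_min_iff.1 hc
    obtain ⟨x, hx, y, hy, z, hz, hxy, hyz, h₁, h₂, h₃⟩ :=
      exists_three_zeros_of_alternating (g := fun t => g t - c) hla ham (hmb.trans hbr)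
        (hg.sub continuousOn_const) (by linarith) (by linarith) (by linarith) (by linarith)
    exact ⟨c, x, hx, y, hy, z, hz, hxy, hyz, by linarith, by linarith, by linarith⟩

/-- If no line of slope at least `K` meets the graph of the continuous function `f` over `[l, r]`
in three points, where `|f| ≤ M` and `2 * M < K * d`, then the slopes of the chords of `f` with
endpoints at distance at least `d` from `l` and `r` are at most `K`. -/
theorem sub_le_mul_sub_of_no_three_points {f : ℝ → ℝ} {l a b r K M d : ℝ} (hd : 0 < d)
    (hla : l + d ≤ a) (hab : a < b) (hbr : b + d ≤ r) (hf : ContinuousOn f (Set.Icc l r))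
    (hM : ∀ t ∈ Set.Icc l r, |f t| ≤ M) (hK : 2 * M < K * d)
    (H : ∀ μ c, K ≤ μ → ∀ x ∈ Set.Icc l r, ∀ y ∈ Set.Icc l r, ∀ z ∈ Set.Icc l r, x < y → y < z →
      f x = μ * x + c → f y = μ * y + c → f z = μ * z + c → False) :
    f b - f a ≤ K * (b - a) := by
  by_contra! hlt
  obtain ⟨s, hs⟩ : ∃ s, s * (b - a) = f b - f a :=
    ⟨(f b - f a) / (b - a), div_mul_cancel₀ _ (sub_pos.2 hab).ne'⟩
  have hKs : K < s := by
    rw [← hs] at hlt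
    exact lt_of_mul_lt_mul_right hlt (sub_pos.2 hab).le
  have hl := abs_le.1 (hM l ⟨le_rfl, by linarith⟩)
  have ha := abs_le.1 (hM a ⟨by linarith, by linarith⟩)
  have hb := abs_le.1 (hM b ⟨by linarith, by linarith⟩)
  have hr := abs_le.1 (hM r ⟨by linarith, le_rfl⟩)
  have hKd : K * d < s * d := mul_lt_mul_of_pos_right hKs hd
  have hs0 : 0 ≤ s := (pos_of_mul_pos_left (by linarith) hd.le).le
  have hsl : s * d ≤ s * (a - l) := mul_le_mul_of_nonneg_left (by linarith) hs0
  have hsr : s * d ≤ s * (r - b) := mul_le_mul_of_nonneg_left (by linarith) hs0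
  obtain ⟨c, x, hx, y, hy, z, hz, hxy, hyz, h₁, h₂, h₃⟩ :=
    exists_three_points_same_value (g := fun t => f t - f a - s * (t - a))
      (show l < a by linarith) hab (show b < r by linarith)
      ((hf.sub continuousOn_const).sub (by fun_prop)) (by linarith) (by ring) (by linarith)
      (by linarith)
  exact H s (f a - s * a + c) hKs.le x hx y hy z hz hxy hyz (by linarith) (by linarith)
    (by linarith)


/-- If `f : (0,1) → ℝ` is continuous and every λ-admissible line
(vertical, or of slope `μ` with `|μ| ≥ λ`) meets the graph of `f` in at most two
points, then `f` is locally Lipschitz on `(0,1)`. -/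
theorem stmt_0 (lam : ℝ) (hlam : 0 < lam) (f : ℝ → ℝ)
    (hf : ContinuousOn f (Set.Ioo 0 1))
    (hlines : ∀ L : Set (ℝ × ℝ),
      ((∃ c : ℝ, L = {p : ℝ × ℝ | p.1 = c}) ∨
        (∃ μ c : ℝ, lam ≤ |μ| ∧ L = {p : ℝ × ℝ | p.2 = μ * p.1 + c})) →
      (L ∩ {p : ℝ × ℝ | p.1 ∈ Set.Ioo (0 : ℝ) 1 ∧ p.2 = f p.1}).encard ≤ 2) :
    ∀ x ∈ Set.Ioo (0 : ℝ) 1, ∃ ε > (0 : ℝ), ∃ K : NNReal,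
      LipschitzOnWith K f (Set.Ioo (0 : ℝ) 1 ∩ Metric.ball x ε) := by
  have H : ∀ μ c, lam ≤ |μ| → ∀ x ∈ Set.Ioo (0 : ℝ) 1, ∀ y ∈ Set.Ioo (0 : ℝ) 1,
      ∀ z ∈ Set.Ioo (0 : ℝ) 1, x < y → y < z →
      f x = μ * x + c → f y = μ * y + c → f z = μ * z + c → False := by
    intro μ c hμ x hx y hy z hz hxy hyz h₁ h₂ h₃
    have hle := hlines {p | p.2 = μ * p.1 + c} (Or.inr ⟨μ, c, hμ, rfl⟩)
    have hsub : ({(x, f x), (y, f y), (z, f z)} : Set (ℝ × ℝ)) ⊆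
        {p | p.2 = μ * p.1 + c} ∩ {p : ℝ × ℝ | p.1 ∈ Set.Ioo (0 : ℝ) 1 ∧ p.2 = f p.1} := by
      rintro p (rfl | rfl | rfl)
      exacts [⟨h₁, hx, rfl⟩, ⟨h₂, hy, rfl⟩, ⟨h₃, hz, rfl⟩]
    have hcard : ({(x, f x), (y, f y), (z, f z)} : Set (ℝ × ℝ)).encard = 3 :=
      Set.encard_eq_three.2 ⟨_, _, _, fun h => hxy.ne (congrArg Prod.fst h),
        fun h => (hxy.trans hyz).ne (congrArg Prod.fst h),
        fun h => hyz.ne (congrArg Prod.fst h), rfl⟩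
    have h32 := (Set.encard_le_encard hsub).trans hle
    rw [hcard] at h32
    exact absurd h32 (by norm_num)
  intro x₀ hx₀
  obtain ⟨d, hd, hdx⟩ := exists_between
    (show 0 < min x₀ (1 - x₀) / 2 from half_pos (lt_min hx₀.1 (sub_pos.2 hx₀.2)))
  have hd0 : 2 * d < x₀ := by linarith [min_le_left x₀ (1 - x₀)]
  have hd1 : 2 * d < 1 - x₀ := by linarith [min_le_right x₀ (1 - x₀)]
  have hsub : Set.Icc (x₀ - 2 * d) (x₀ + 2 * d) ⊆ Set.Ioo 0 1 := fun t ht =>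
    ⟨by linarith [ht.1], by linarith [ht.2]⟩
  have hfc := hf.mono hsub
  obtain ⟨M, hM⟩ := isCompact_Icc.exists_bound_of_continuousOn hfc
  simp only [Real.norm_eq_abs] at hM
  have hM0 : 0 ≤ M := (abs_nonneg _).trans (hM x₀ ⟨by linarith, by linarith⟩)
  set K : ℝ := lam + 2 * M / d with hKdef
  have hK : 2 * M < K * d := by
    rw [hKdef, add_mul, div_mul_cancel₀ _ hd.ne']
    linarith [mul_pos hlam hd]
  have hlamK : lam ≤ K := le_add_of_nonneg_right (by positivity)
  have hK0 : 0 ≤ K := hlam.le.trans hlamK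
  have key : ∀ a b, a ∈ Metric.ball x₀ d → b ∈ Metric.ball x₀ d → a < b →
      |f a - f b| ≤ K * |a - b| := by
    intro a b ha hb hab
    rw [Real.ball_eq_Ioo] at ha hb
    have hal : x₀ - 2 * d + d ≤ a := by linarith [ha.1]
    have hbr : b + d ≤ x₀ + 2 * d := by linarith [hb.2]
    have hup := sub_le_mul_sub_of_no_three_points hd hal hab hbr hfc hM hK
      fun μ c hμ x hx y hy z hz => H μ c ((hlamK.trans hμ).trans (le_abs_self μ))
        x (hsub hx) y (hsub hy) z (hsub hz)
    have hdown := sub_le_mul_sub_of_no_three_points (f := fun t => -f t) hd hal hab hbr hfc.neg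
      (fun t ht => (abs_neg (f t)).le.trans (hM t ht)) hK
      fun μ c hμ x hx y hy z hz hxy hyz h₁ h₂ h₃ =>
        H (-μ) (-c) ((hlamK.trans hμ).trans ((le_abs_self μ).trans (abs_neg μ).ge))
          x (hsub hx) y (hsub hy) z (hsub hz) hxy hyz (by linarith) (by linarith) (by linarith)
    rw [abs_sub_comm a b, abs_of_pos (sub_pos.2 hab), abs_le]
    constructor <;> linarith
  refine ⟨d, hd, K.toNNReal, LipschitzOnWith.of_dist_le_mul fun a ha b hb => ?_⟩
  rw [Real.coe_toNNReal K hK0, Real.dist_eq, Real.dist_eq]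
  rcases lt_trichotomy a b with hab | rfl | hab
  · exact key a b ha.2 hb.2 hab
  · simp
  · rw [abs_sub_comm (f a), abs_sub_comm a]
    exact key b a hb.2 ha.2 hab
end

section
/- Let λ₁ > 0 > λ₂ and let f : (0,1) → ℝ be a continuous function. Suppose that every line in ℝ² that is vertical, or whose slope μ satisfies μ ≥ λ₁ or μ ≤ λ₂, intersects the graph of f in at most two points. Then f is locally Lipschitz on (0,1). -/
/-- A continuous function that changes sign three times along `p < a < m < q` has three zeros. -/
theorem exists_three_zeros {g : ℝ → ℝ} {p a m q : ℝ} (hpa : p < a) (ham : a < m) (hmq : m < q)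
    (hg : ContinuousOn g (Set.Icc p q)) (hp : 0 < g p) (ha : g a < 0) (hm : 0 < g m)
    (hq : g q < 0) :
    ∃ x y z, p < x ∧ x < y ∧ y < z ∧ z < q ∧ g x = 0 ∧ g y = 0 ∧ g z = 0 := by
  obtain ⟨x, hx, hx0⟩ := intermediate_value_Ioo' hpa.le
    (hg.mono (Set.Icc_subset_Icc le_rfl (by linarith))) ⟨ha, hp⟩
  obtain ⟨y, hy, hy0⟩ := intermediate_value_Ioo ham.le
    (hg.mono (Set.Icc_subset_Icc hpa.le hmq.le)) ⟨ha, hm⟩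
  obtain ⟨z, hz, hz0⟩ := intermediate_value_Ioo' hmq.le
    (hg.mono (Set.Icc_subset_Icc (by linarith) le_rfl)) ⟨hq, hm⟩
  exact ⟨x, y, z, hx.1, hx.2.trans hy.1, hy.2.trans hz.1, hz.2, hx0, hy0, hz0⟩

/-- If the line of slope `s` through two points of a graph lies below the graph at some point to
the left and above it at some point to the right, then some parallel line meets the graph in three
points. -/
theorem exists_line_three_points {f : ℝ → ℝ} {p a b q s : ℝ} (hpa : p < a) (hab : a < b)
    (hbq : b < q) (hf : ContinuousOn f (Set.Icc p q)) (hs : f b - f a = s * (b - a))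
    (hp : f a + s * (p - a) < f p) (hq : f q < f b + s * (q - b)) :
    ∃ c x y z, p < x ∧ x < y ∧ y < z ∧ z < q ∧
      f x = s * x + c ∧ f y = s * y + c ∧ f z = s * z + c := by
  have hcont (c : ℝ) : ContinuousOn (fun x => f x - (s * x + c)) (Set.Icc p q) :=
    hf.sub (by fun_prop)
  obtain ⟨m, ham, hmb⟩ := exists_between hab
  rcases lt_trichotomy (f m) (f a + s * (m - a)) with h | h | h
  · obtain ⟨δ, hδ, hδm⟩ := exists_between (lt_min (sub_pos.2 h) (sub_pos.2 hq))
    obtain ⟨h₁, h₂⟩ := lt_min_iff.1 hδm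
    obtain ⟨x, y, z, hpx, hxy, hyz, hzq, hx, hy, hz⟩ :=
      exists_three_zeros (hpa.trans ham) hmb hbq (hcont (f a - s * a - δ))
        (by linarith) (by linarith) (by linarith) (by linarith)
    exact ⟨_, x, y, z, hpx, hxy, hyz, hzq, sub_eq_zero.1 hx, sub_eq_zero.1 hy, sub_eq_zero.1 hz⟩
  · exact ⟨f a - s * a, a, m, b, hpa, ham, hmb, hbq, by ring, by linarith, by linarith⟩
  · obtain ⟨δ, hδ, hδm⟩ := exists_between (lt_min (sub_pos.2 h) (sub_pos.2 hp))
    obtain ⟨h₁, h₂⟩ := lt_min_iff.1 hδm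
    obtain ⟨x, y, z, hpx, hxy, hyz, hzq, hx, hy, hz⟩ :=
      exists_three_zeros hpa ham (hmb.trans hbq) (hcont (f a - s * a + δ))
        (by linarith) (by linarith) (by linarith) (by linarith)
    exact ⟨_, x, y, z, hpx, hxy, hyz, hzq, sub_eq_zero.1 hx, sub_eq_zero.1 hy, sub_eq_zero.1 hz⟩

/-- If no line of slope at least `L` meets the graph of `f` over `[p, q]` in three points, then `f`
increases at a bounded rate away from the endpoints of `[p, q]`. -/
theorem sub_le_mul_sub_of_no_three_points_s1 {f : ℝ → ℝ} {p q ε M L a b : ℝ} (hε : 0 < ε)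
    (hf : ContinuousOn f (Set.Icc p q)) (hM : ∀ x ∈ Set.Icc p q, |f x| ≤ M)
    (hlines : ∀ s c x y z, L ≤ s → p < x → x < y → y < z → z < q →
      f x = s * x + c → f y = s * y + c → f z = s * z + c → False)
    (hpa : p + ε < a) (hab : a < b) (hbq : b + ε < q) :
    f b - f a ≤ max L (2 * M / ε) * (b - a) := by
  by_contra! h
  have hs := (lt_div_iff₀ (sub_pos.2 hab)).2 h
  obtain ⟨hL, hMs⟩ := max_lt_iff.1 hs
  set s := (f b - f a) / (b - a) with hs_def
  have hsab : f b - f a = s * (b - a) := by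
    rw [hs_def, div_mul_cancel₀ _ (sub_pos.2 hab).ne']
  have hMs' : 2 * M < s * ε := (div_lt_iff₀ hε).1 hMs
  have bound (x : ℝ) (h₁ : p ≤ x) (h₂ : x ≤ q) := abs_le.1 (hM x ⟨h₁, h₂⟩)
  have hP := bound p le_rfl (by linarith)
  have hA := bound a (by linarith) (by linarith)
  have hB := bound b (by linarith) (by linarith)
  have hQ := bound q (by linarith) le_rfl
  have hs0 : 0 < s := pos_of_mul_pos_left (by linarith : 0 < s * ε) hε.le
  have h₁ : s * ε ≤ s * (a - p) := by gcongr; linarith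
  have h₂ : s * ε ≤ s * (q - b) := by gcongr; linarith
  obtain ⟨c, x, y, z, hpx, hxy, hyz, hzq, hx, hy, hz⟩ :=
    exists_line_three_points (by linarith) hab (by linarith) hf hsab (by linarith) (by linarith)
  exact hlines s c x y z hL.le hpx hxy hyz hzq hx hy hz


/-- If `λ₁ > 0 > λ₂` and every line that is vertical or has slope
`μ ≥ λ₁` or `μ ≤ λ₂` meets the graph of the continuous `f : (0,1) → ℝ` in at
most two points, then `f` is locally Lipschitz on `(0,1)`. -/
theorem stmt_1 (lam₁ lam₂ : ℝ) (hlam₁ : 0 < lam₁) (hlam₂ : lam₂ < 0) (f : ℝ → ℝ)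
    (hf : ContinuousOn f (Set.Ioo 0 1))
    (hlines : ∀ L : Set (ℝ × ℝ),
      ((∃ c : ℝ, L = {p : ℝ × ℝ | p.1 = c}) ∨
        (∃ μ c : ℝ, (lam₁ ≤ μ ∨ μ ≤ lam₂) ∧ L = {p : ℝ × ℝ | p.2 = μ * p.1 + c})) →
      (L ∩ {p : ℝ × ℝ | p.1 ∈ Set.Ioo (0 : ℝ) 1 ∧ p.2 = f p.1}).encard ≤ 2) :
    ∀ x ∈ Set.Ioo (0 : ℝ) 1, ∃ ε > (0 : ℝ), ∃ K : NNReal,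
      LipschitzOnWith K f (Set.Ioo (0 : ℝ) 1 ∩ Metric.ball x ε) := by
  intro x₀ ⟨hx₀, hx₁⟩
  have no_three (s c x y z : ℝ) (hs : lam₁ ≤ s ∨ s ≤ lam₂) (h0 : 0 < x) (hxy : x < y)
      (hyz : y < z) (h1 : z < 1) (hx : f x = s * x + c) (hy : f y = s * y + c)
      (hz : f z = s * z + c) : False := by
    have hsub : ({(x, f x), (y, f y), (z, f z)} : Set (ℝ × ℝ)) ⊆
        {p : ℝ × ℝ | p.2 = s * p.1 + c} ∩
          {p : ℝ × ℝ | p.1 ∈ Set.Ioo (0 : ℝ) 1 ∧ p.2 = f p.1} := by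
      rintro _ (rfl | rfl | rfl)
      · exact ⟨hx, ⟨h0, by linarith⟩, rfl⟩
      · exact ⟨hy, ⟨by linarith, by linarith⟩, rfl⟩
      · exact ⟨hz, ⟨by linarith, h1⟩, rfl⟩
    have hcard := (Set.encard_le_encard hsub).trans (hlines _ (Or.inr ⟨s, c, hs, rfl⟩))
    rw [Set.encard_eq_three.2 ⟨_, _, _, fun h => hxy.ne (congrArg Prod.fst h),
      fun h => (hxy.trans hyz).ne (congrArg Prod.fst h),
      fun h => hyz.ne (congrArg Prod.fst h), rfl⟩] at hcard
    exact absurd hcard (by norm_num)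
  obtain ⟨ε, hε, hεlt⟩ := exists_between
    (lt_min (half_pos hx₀) (half_pos (sub_pos.2 hx₁)))
  obtain ⟨hε₀, hε₁⟩ := lt_min_iff.1 hεlt
  have hcont : ContinuousOn f (Set.Icc (x₀ - 2 * ε) (x₀ + 2 * ε)) :=
    hf.mono fun x hx => ⟨by linarith [hx.1], by linarith [hx.2]⟩
  obtain ⟨M, hM⟩ := isCompact_Icc.exists_bound_of_continuousOn hcont
  have up {a b : ℝ} (ha : x₀ - ε < a) (hab : a < b) (hb : b < x₀ + ε) :
      f b - f a ≤ max lam₁ (2 * M / ε) * (b - a) :=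
    sub_le_mul_sub_of_no_three_points_s1 hε hcont hM
      (fun s c x y z hs hpx hxy hyz hzq hx hy hz => no_three s c x y z (Or.inl hs)
        (by linarith) hxy hyz (by linarith) hx hy hz)
      (by linarith) hab (by linarith)
  have down {a b : ℝ} (ha : x₀ - ε < a) (hab : a < b) (hb : b < x₀ + ε) :
      -f b - -f a ≤ max (-lam₂) (2 * M / ε) * (b - a) :=
    sub_le_mul_sub_of_no_three_points_s1 (f := fun x => -f x) hε hcont.neg
      (fun x hx => (abs_neg (f x)).trans_le (hM x hx))
      (fun s c x y z hs hpx hxy hyz hzq hx hy hz => no_three (-s) (-c) x y z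
        (Or.inr (by linarith)) (by linarith) hxy hyz (by linarith)
        (by linarith) (by linarith) (by linarith))
      (by linarith) hab (by linarith)
  set K := max (max lam₁ (2 * M / ε)) (max (-lam₂) (2 * M / ε))
  have key {a b : ℝ} (ha : x₀ - ε < a) (hab : a < b) (hb : b < x₀ + ε) :
      |f b - f a| ≤ K * |b - a| := by
    have hba := sub_pos.2 hab
    rw [abs_of_pos hba, abs_le]
    have h₁ : f b - f a ≤ K * (b - a) :=
      (up ha hab hb).trans (mul_le_mul_of_nonneg_right (le_max_left _ _) hba.le)
    have h₂ : -f b - -f a ≤ K * (b - a) :=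
      (down ha hab hb).trans (mul_le_mul_of_nonneg_right (le_max_right _ _) hba.le)
    constructor <;> linarith
  refine ⟨ε, hε, K.toNNReal, LipschitzOnWith.of_dist_le' ?_⟩
  rintro a ⟨-, ha⟩ b ⟨-, hb⟩
  rw [Real.ball_eq_Ioo] at ha hb
  rw [Real.dist_eq, Real.dist_eq]
  rcases lt_trichotomy a b with h | rfl | h
  · rw [abs_sub_comm (f a), abs_sub_comm a]
    exact key ha.1 h hb.2
  · simp
  · exact key hb.1 h ha.2
end

section
/- Let λ > 0 and let f : [0,1] → ℝ be a continuous function such that every λ-admissible line in ℝ² (i.e. every line that is vertical or whose slope μ satisfies |μ| ≥ λ) intersects the graph of f in at most two points. Then the restriction of f to the open interval (0,1) is locally Lipschitz. -/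
/-- A continuous function which alternates between high, low, high and low values takes some
value at least three times. -/
theorem exists_three_eq_of_alternating {g : ℝ → ℝ} {p q s t : ℝ} (hg : ContinuousOn g (Set.Icc p t))
    (hpq : p < q) (hqs : q < s) (hst : s < t)
    (h₁ : g q < g p) (h₂ : g q < g s) (h₃ : g t < g p) (h₄ : g t < g s) :
    ∃ u ∈ Set.Icc p t, ∃ v ∈ Set.Icc p t, ∃ w ∈ Set.Icc p t,
      u < v ∧ v < w ∧ g u = g v ∧ g v = g w := by
  obtain ⟨d, hd, hd'⟩ := exists_between (max_lt (lt_min h₁ h₂) (lt_min h₃ h₄))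
  rw [max_lt_iff] at hd
  rw [lt_min_iff] at hd'
  obtain ⟨u, hu, hud⟩ := intermediate_value_Ioo' hpq.le
    (hg.mono (Set.Icc_subset_Icc le_rfl (hqs.trans hst).le)) ⟨hd.1, hd'.1⟩
  obtain ⟨v, hv, hvd⟩ := intermediate_value_Ioo hqs.le
    (hg.mono (Set.Icc_subset_Icc hpq.le hst.le)) ⟨hd.1, hd'.2⟩
  obtain ⟨w, hw, hwd⟩ := intermediate_value_Ioo' hst.le
    (hg.mono (Set.Icc_subset_Icc (hpq.trans hqs).le le_rfl)) ⟨hd.2, hd'.2⟩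
  simp only [Set.mem_Ioo] at hu hv hw
  exact ⟨u, ⟨by linarith, by linarith⟩, v, ⟨by linarith, by linarith⟩, w,
    ⟨by linarith, by linarith⟩, by linarith, by linarith, by rw [hud, hvd], by rw [hvd, hwd]⟩

/-- If a continuous function on `[a, b]` takes a common value at two interior points, lying strictly
between its values at the end points, then it takes some value at least three times. -/
theorem exists_three_eq_of_eq_of_lt {g : ℝ → ℝ} {a b x y : ℝ} (hg : ContinuousOn g (Set.Icc a b))
    (hax : a < x) (hxy : x < y) (hyb : y < b) (heq : g x = g y) (ha : g x < g a) (hb : g b < g y) :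
    ∃ u ∈ Set.Icc a b, ∃ v ∈ Set.Icc a b, ∃ w ∈ Set.Icc a b,
      u < v ∧ v < w ∧ g u = g v ∧ g v = g w := by
  obtain ⟨m, hxm, hmy⟩ := exists_between hxy
  rcases lt_trichotomy (g m) (g x) with h | h | h
  · have hsub : Set.Icc x b ⊆ Set.Icc a b := Set.Icc_subset_Icc hax.le le_rfl
    obtain ⟨u, hu, v, hv, w, hw, H⟩ := exists_three_eq_of_alternating (hg.mono hsub)
      hxm hmy hyb h (h.trans_eq heq) (hb.trans_eq heq.symm) hb
    exact ⟨u, hsub hu, v, hsub hv, w, hsub hw, H⟩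
  · exact ⟨x, ⟨hax.le, (hxy.trans hyb).le⟩, m, ⟨(hax.trans hxm).le, (hmy.trans hyb).le⟩,
      y, ⟨(hax.trans hxy).le, hyb.le⟩, hxm, hmy, h.symm, h.trans heq⟩
  · have hsub : Set.Icc a y ⊆ Set.Icc a b := Set.Icc_subset_Icc le_rfl hyb.le
    obtain ⟨u, hu, v, hv, w, hw, H⟩ := exists_three_eq_of_alternating (hg.mono hsub)
      hax hxm hmy ha h (heq ▸ ha) (heq ▸ h)
    exact ⟨u, hsub hu, v, hsub hv, w, hsub hw, H⟩

/-- If `f` is bounded by `B` on `[0, 1]` and no function `f - μ x` with `lam ≤ |μ|` takes a value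
three times, then `f` has no secant steeper than `max lam (2 * B / ε)` between points at distance at
least `ε` from the end points. -/
theorem sub_le_mul_sub_of_forall_not_three {f : ℝ → ℝ} {lam B ε K x y : ℝ}
    (hf : ContinuousOn f (Set.Icc 0 1)) (hB : ∀ z ∈ Set.Icc (0 : ℝ) 1, |f z| ≤ B)
    (hthree : ∀ μ : ℝ, lam ≤ |μ| → ∀ u ∈ Set.Icc (0 : ℝ) 1, ∀ v ∈ Set.Icc (0 : ℝ) 1,
      ∀ w ∈ Set.Icc (0 : ℝ) 1, u < v → v < w →
      f u - μ * u = f v - μ * v → f v - μ * v ≠ f w - μ * w)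
    (hε : 0 < ε) (hlam : lam ≤ K) (hK0 : 0 ≤ K) (hK : 2 * B ≤ K * ε)
    (hx : ε ≤ x) (hxy : x < y) (hy : y ≤ 1 - ε) : f y - f x ≤ K * (y - x) := by
  by_contra! h
  set μ := (f y - f x) / (y - x) with hμ
  have hyx : 0 < y - x := sub_pos.2 hxy
  have hKμ : K < μ := by rwa [hμ, lt_div_iff₀ hyx]
  have hμeq : μ * (y - x) = f y - f x := div_mul_cancel₀ _ hyx.ne'
  have hKε : K * ε < μ * ε := mul_lt_mul_of_pos_right hKμ hε
  have hμx : μ * ε ≤ μ * x := mul_le_mul_of_nonneg_left hx (hK0.trans hKμ.le)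
  have hμy : μ * ε ≤ μ * (1 - y) :=
    mul_le_mul_of_nonneg_left (by linarith) (hK0.trans hKμ.le)
  have h0 := abs_le.1 (hB 0 ⟨le_rfl, zero_le_one⟩)
  have h1 := abs_le.1 (hB 1 ⟨zero_le_one, le_rfl⟩)
  have hfx := abs_le.1 (hB x ⟨by linarith, by linarith⟩)
  have hfy := abs_le.1 (hB y ⟨by linarith, by linarith⟩)
  obtain ⟨u, hu, v, hv, w, hw, huv, hvw, e₁, e₂⟩ :=
    exists_three_eq_of_eq_of_lt (g := fun z => f z - μ * z) (hf.sub (by fun_prop))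
      (by linarith : 0 < x) hxy (by linarith : y < 1) (by linarith)
      (by linarith) (by linarith)
  exact hthree μ (hlam.trans (hKμ.le.trans (le_abs_self μ))) u hu v hv w hw huv hvw e₁ e₂


/-- If `f : [0,1] → ℝ` is continuous and every λ-admissible line
(vertical, or of slope `μ` with `|μ| ≥ λ`) meets the graph of `f` over `[0,1]`
in at most two points, then the restriction of `f` to `(0,1)` is locally
Lipschitz. -/
theorem stmt_2 (lam : ℝ) (hlam : 0 < lam) (f : ℝ → ℝ)
    (hf : ContinuousOn f (Set.Icc 0 1))
    (hlines : ∀ L : Set (ℝ × ℝ),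
      ((∃ c : ℝ, L = {p : ℝ × ℝ | p.1 = c}) ∨
        (∃ μ c : ℝ, lam ≤ |μ| ∧ L = {p : ℝ × ℝ | p.2 = μ * p.1 + c})) →
      (L ∩ {p : ℝ × ℝ | p.1 ∈ Set.Icc (0 : ℝ) 1 ∧ p.2 = f p.1}).encard ≤ 2) :
    ∀ x ∈ Set.Ioo (0 : ℝ) 1, ∃ ε > (0 : ℝ), ∃ K : NNReal,
      LipschitzOnWith K f (Set.Ioo (0 : ℝ) 1 ∩ Metric.ball x ε) := by
  intro x hx
  have hthree : ∀ μ : ℝ, lam ≤ |μ| → ∀ u ∈ Set.Icc (0 : ℝ) 1, ∀ v ∈ Set.Icc (0 : ℝ) 1,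
      ∀ w ∈ Set.Icc (0 : ℝ) 1, u < v → v < w →
      f u - μ * u = f v - μ * v → f v - μ * v ≠ f w - μ * w := by
    intro μ hμ u hu v hv w hw huv hvw e₁ e₂
    have hle := hlines _ (Or.inr ⟨μ, f u - μ * u, hμ, rfl⟩)
    refine (Set.encard_le_encard (s := {(u, f u), (v, f v), (w, f w)}) ?_).trans hle |>.not_gt ?_
    · rintro p (rfl | rfl | rfl)
      · exact ⟨by simp, hu, rfl⟩
      · exact ⟨by simp only [Set.mem_ofPred_eq]; linarith, hv, rfl⟩
      · exact ⟨by simp only [Set.mem_ofPred_eq]; linarith, hw, rfl⟩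
    · rw [Set.encard_eq_three.2 ⟨_, _, _, fun h => huv.ne (congrArg Prod.fst h),
        fun h => (huv.trans hvw).ne (congrArg Prod.fst h),
        fun h => hvw.ne (congrArg Prod.fst h), rfl⟩]
      norm_num
  obtain ⟨B, hB⟩ := isCompact_Icc.exists_bound_of_continuousOn hf
  simp only [Real.norm_eq_abs] at hB
  have hB0 : 0 ≤ B := (abs_nonneg _).trans (hB 0 ⟨le_rfl, zero_le_one⟩)
  obtain ⟨ε, hε, hεx⟩ : ∃ ε > 0, 2 * ε ≤ x ∧ 2 * ε ≤ 1 - x := by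
    refine ⟨min x (1 - x) / 2, half_pos (lt_min hx.1 (sub_pos.2 hx.2)), ?_, ?_⟩
    · linarith [min_le_left x (1 - x)]
    · linarith [min_le_right x (1 - x)]
  have hK0 : 0 ≤ lam + 2 * B / ε := by positivity
  have hlamK : lam ≤ lam + 2 * B / ε := le_add_of_nonneg_right (by positivity)
  have hK : 2 * B ≤ (lam + 2 * B / ε) * ε := by
    rw [add_mul, div_mul_cancel₀ _ hε.ne']
    exact le_add_of_nonneg_left (by positivity)
  have key : ∀ y z, ε ≤ y → y < z → z ≤ 1 - ε →
      |f y - f z| ≤ (lam + 2 * B / ε) * |y - z| := by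
    intro y z hy hyz hz
    rw [abs_sub_comm (f y), abs_sub_comm y, abs_of_pos (sub_pos.2 hyz), abs_le']
    refine ⟨sub_le_mul_sub_of_forall_not_three hf hB hthree hε hlamK hK0 hK hy hyz hz, ?_⟩
    have := sub_le_mul_sub_of_forall_not_three (f := fun t => -f t) hf.neg
      (by simpa only [abs_neg] using hB)
      (fun μ hμ u hu v hv w hw huv hvw e₁ e₂ => hthree (-μ) (by rwa [abs_neg]) u hu v hv w hw
        huv hvw (by linarith) (by linarith)) hε hlamK hK0 hK hy hyz hz
    linarith
  refine ⟨ε, hε, ⟨lam + 2 * B / ε, hK0⟩, LipschitzOnWith.of_dist_le_mul ?_⟩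
  rintro y ⟨-, hy⟩ z ⟨-, hz⟩
  rw [Metric.mem_ball, Real.dist_eq, abs_lt] at hy hz
  rw [Real.dist_eq, Real.dist_eq]
  change |f y - f z| ≤ (lam + 2 * B / ε) * |y - z|
  rcases lt_trichotomy y z with h | rfl | h
  · exact key y z (by linarith) h (by linarith)
  · simp
  · rw [abs_sub_comm (f y), abs_sub_comm y]
    exact key z y (by linarith) h (by linarith)
end

section
/- Let γ : [0,1] → ℝ² be a continuous curve, and fix an integer k ≥ 2, an angle φ ∈ (0, π/2) and a rotation ρ ∈ [0, 2π). Suppose that every admissible line (every line contained in C_P(φ,ρ) for some point P ∈ ℝ²) intersects the image of γ in at most k points. Then the image of γ can be written as a countable union of sets each of finite 1-dimensional Hausdorff measure; that is, the image of γ is σ-finite with respect to H¹. -/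
/-- The closed vertical cone `C(φ,0) = {(x,y) : |y| ≥ tan(φ)·|x|}`, rotated
counter-clockwise by the angle `ρ`, as a subset of the Euclidean plane. -/
def rotCone (φ ρ : ℝ) : Set (EuclideanSpace ℝ (Fin 2)) :=
  {p | Real.tan φ * |Real.cos ρ * p 0 + Real.sin ρ * p 1| ≤
      |(-Real.sin ρ) * p 0 + Real.cos ρ * p 1|}

/-- The translate `C_P(φ,ρ) = P + C(φ,ρ)` of the cone, with vertex `P`. -/
def rotConeAt (P : EuclideanSpace ℝ (Fin 2)) (φ ρ : ℝ) : Set (EuclideanSpace ℝ (Fin 2)) :=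
  {q | q - P ∈ rotCone φ ρ}

/-- A (straight) line in the Euclidean plane. -/
def IsLine (L : Set (EuclideanSpace ℝ (Fin 2))) : Prop :=
  ∃ a b c : ℝ, (a ≠ 0 ∨ b ≠ 0) ∧ L = {p | a * p 0 + b * p 1 = c}

open MeasureTheory Metric Set Filter
open scoped ENNReal NNReal Topology

/-- If all sufficiently fine finite separated subsets of a compact set `K` satisfy
`#F * ε ≤ M`, then `K` has 1-dimensional Hausdorff measure at most `2 * M`. -/
lemma hausdorffMeasure_one_le_of_card_separated_le {X : Type*} [MetricSpace X]
    [MeasurableSpace X] [BorelSpace X] {K : Set X} (hK : IsCompact K) {M : ℝ≥0∞} {ε₀ : ℝ≥0}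
    (hε₀ : 0 < ε₀)
    (h : ∀ ε : ℝ≥0, 0 < ε → ε ≤ ε₀ → ∀ F : Finset X, (F : Set X) ⊆ K →
      IsSeparated (ε : ℝ≥0∞) (F : Set X) → (F.card : ℝ≥0∞) * ε ≤ M) :
    Measure.hausdorffMeasure 1 K ≤ 2 * M := by
  have key : ∀ ε : ℝ≥0, 0 < ε → ∃ F : Finset X, (F : Set X) ⊆ K ∧
      IsSeparated (ε : ℝ≥0∞) (F : Set X) ∧ IsCover ε K (F : Set X) := by
    intro ε hε
    have hfin : packingNumber ε K ≠ ⊤ := by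
      obtain ⟨N, -, hNfin, hN⟩ :=
        exists_finite_isCover_of_isCompact (ε := ε / 2) (by positivity) hK
      have h1 := packingNumber_two_mul_le_externalCoveringNumber (ε / 2) K
      rw [mul_div_cancel₀ ε two_ne_zero] at h1
      exact ((h1.trans hN.externalCoveringNumber_le_encard).trans_lt
        hNfin.encard_lt_top).ne
    have hF : (maximalSeparatedSet ε K).Finite := by
      rw [← encard_lt_top_iff, encard_maximalSeparatedSet hfin]
      exact hfin.lt_top
    refine ⟨hF.toFinset, ?_⟩
    rw [hF.coe_toFinset]
    exact ⟨maximalSeparatedSet_subset, isSeparated_maximalSeparatedSet,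
      isCover_maximalSeparatedSet hfin⟩
  obtain ⟨e, -, he, he0⟩ := exists_seq_strictAnti_tendsto' hε₀
  choose F hFK hFsep hFcov using fun n : ℕ => key _ (he n).1
  have hdiam : ∀ n (i : F n), ediam (closedBall (i : X) (e n)) ≤
      2 * (e n) := by
    intro n i
    rw [← closedEBall_coe]
    exact ediam_closedEBall_le
  have htend : Tendsto (fun n : ℕ => 2 * (e n : ℝ≥0∞)) atTop (𝓝 0) := by
    have h2 := ENNReal.Tendsto.const_mul (a := 2) (ENNReal.tendsto_coe.2 he0) (Or.inr (by simp))
    simpa using h2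
  refine (Measure.hausdorffMeasure_le_liminf_sum (ι := fun n => F n) 1 K _ htend
    (fun n i => closedBall (i : X) (e n))
    (Eventually.of_forall hdiam) (Eventually.of_forall fun n => ?_)).trans ?_
  · intro x hx
    have := (hFcov n).subset_iUnion_closedBall hx
    simpa using this
  · refine (liminf_le_liminf (v := fun _ => 2 * M) (Eventually.of_forall fun n => ?_)).trans ?_
    · calc ∑ i : F n, ediam (closedBall (i : X) (e n)) ^ (1 : ℝ)
          ≤ ∑ i : F n, 2 * (e n : ℝ≥0∞) := by
            refine Finset.sum_le_sum fun i _ => ?_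
            rw [ENNReal.rpow_one]
            exact hdiam n i
        _ = 2 * ((F n).card * (e n : ℝ≥0∞)) := by
            simp only [Finset.sum_const, Finset.card_univ, Fintype.card_coe, nsmul_eq_mul]
            ring
        _ ≤ 2 * M := by
            gcongr
            exact h _ (he n).1 (he n).2.le (F n) (hFK n) (hFsep n)
    · simp

/-- From any point of a continuous curve one can follow the curve up to distance `r`, staying in
the closed ball of radius `r`, as long as the curve reaches distance `r` at all. -/
lemma exists_subcontinuum_closedBall {X : Type*} [MetricSpace X] {γ : ℝ → X}
    (hγ : ContinuousOn γ (Icc 0 1)) {a b : ℝ} (ha : a ∈ Icc (0 : ℝ) 1) (hb : b ∈ Icc (0 : ℝ) 1)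
    {r : ℝ} (hr : 0 ≤ r) (hab : r ≤ dist (γ b) (γ a)) :
    ∃ C ⊆ γ '' Icc 0 1, IsCompact C ∧ IsPreconnected C ∧ C ⊆ closedBall (γ a) r ∧ γ a ∈ C ∧
      ∃ z ∈ C, dist z (γ a) = r := by
  set g : ℝ → X := fun τ => γ (a + τ * (b - a)) with hg
  have hmaps : MapsTo (fun τ : ℝ => a + τ * (b - a)) (Icc 0 1) (Icc 0 1) := by
    intro τ hτ
    have := (convex_Icc (0 : ℝ) 1).add_smul_sub_mem ha hb hτ
    simpa using this
  have hgc : ContinuousOn g (Icc 0 1) := hγ.comp (by fun_prop) hmaps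
  have hfc : ContinuousOn (fun τ => dist (g τ) (γ a)) (Icc 0 1) :=
    continuous_dist.comp_continuousOn (hgc.prodMk continuousOn_const)
  have h0 : dist (g 0) (γ a) = 0 := by simp [hg]
  have h1 : dist (g 1) (γ a) = dist (γ b) (γ a) := by simp [hg]
  have ivt : ∀ τ ∈ Icc (0 : ℝ) 1, r ≤ dist (g τ) (γ a) →
      ∃ σ ∈ Icc 0 τ, dist (g σ) (γ a) = r := by
    intro τ hτ hle
    have := intermediate_value_Icc hτ.1 (hfc.mono (Icc_subset_Icc_right hτ.2))
    exact this ⟨by simpa [h0] using hr, hle⟩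
  set S : Set ℝ := Icc 0 1 ∩ (fun τ => dist (g τ) (γ a)) ⁻¹' {r} with hS
  have hSc : IsCompact S :=
    isCompact_Icc.of_isClosed_subset (hfc.preimage_isClosed_of_isClosed isClosed_Icc
      isClosed_singleton) inter_subset_left
  have hSn : S.Nonempty := by
    obtain ⟨σ, hσ, hσr⟩ := ivt 1 (by simp) (by rw [h1]; exact hab)
    exact ⟨σ, hσ, hσr⟩
  obtain ⟨s, ⟨hs01, hsr⟩, hsmin⟩ := hSc.exists_isLeast hSn
  have hsub : Icc 0 s ⊆ Icc (0 : ℝ) 1 := Icc_subset_Icc_right hs01.2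
  refine ⟨g '' Icc 0 s, ?_, isCompact_Icc.image_of_continuousOn (hgc.mono hsub),
    isPreconnected_Icc.image _ (hgc.mono hsub), ?_, ⟨0, ⟨le_rfl, hs01.1⟩, by simp [hg]⟩,
    g s, ⟨s, ⟨hs01.1, le_rfl⟩, rfl⟩, hsr⟩
  · rintro _ ⟨τ, hτ, rfl⟩
    exact ⟨_, hmaps (hsub hτ), rfl⟩
  · rintro _ ⟨τ, hτ, rfl⟩
    rw [mem_closedBall]
    by_contra! hlt
    obtain ⟨σ, hσ, hσr⟩ := ivt τ (hsub hτ) hlt.le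
    have hsσ : s ≤ σ := hsmin ⟨⟨hσ.1, hσ.2.trans (hsub hτ).2⟩, hσr⟩
    have : τ = s := le_antisymm hτ.2 (hsσ.trans hσ.2)
    rw [this] at hlt
    exact hlt.ne' hsr

/-- Disjoint subsets of a set whose `u`-fibres have at most `k` points have `u`-images of total
length at most `k` times the length of the whole image. -/
lemma sum_volume_image_le_of_fiber_encard_le {X ι : Type*} {K : Set X} {u : X → ℝ} {k : ℕ}
    (hfib : ∀ c, ({x | u x = c} ∩ K).encard ≤ k) (F : Finset ι) (C : ι → Set X)
    (hCK : ∀ i ∈ F, C i ⊆ K) (hdisj : (F : Set ι).PairwiseDisjoint C)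
    (hmeas : ∀ i ∈ F, MeasurableSet (u '' C i)) (hKmeas : MeasurableSet (u '' K)) :
    ∑ i ∈ F, volume (u '' C i) ≤ k * volume (u '' K) := by
  classical
  calc ∑ i ∈ F, volume (u '' C i)
      = ∑ i ∈ F, ∫⁻ c, (u '' C i).indicator 1 c :=
        Finset.sum_congr rfl fun i hi => (lintegral_indicator_one (hmeas i hi)).symm
    _ = ∫⁻ c, ∑ i ∈ F, (u '' C i).indicator 1 c :=
        (lintegral_finsetSum' _ fun i hi =>
          (measurable_one.indicator (hmeas i hi)).aemeasurable).symm
    _ ≤ ∫⁻ c, k * (u '' K).indicator 1 c := by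
        refine lintegral_mono fun c => ?_
        by_cases hc : c ∈ u '' K
        · have hsum : ∑ i ∈ F, (u '' C i).indicator (1 : ℝ → ℝ≥0∞) c =
              ((F.filter fun i => c ∈ u '' C i).card : ℝ≥0∞) := by
            simp [indicator_apply, Finset.sum_boole]
          simp only [hsum, indicator_of_mem hc, Pi.one_apply, mul_one]
          have hex : ∀ i ∈ F.filter fun i => c ∈ u '' C i, ∃ x, x ∈ C i ∧ u x = c :=
            fun i hi => (Finset.mem_filter.1 hi).2
          have : Nonempty X := ⟨hc.choose⟩
          choose! p hp hpc using hex
          have hinj : InjOn p ((F.filter fun i => c ∈ u '' C i : Finset ι) : Set ι) := by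
            intro i hi j hj hij
            by_contra hne
            refine disjoint_left.1 (hdisj (Finset.mem_filter.1 hi).1
              (Finset.mem_filter.1 hj).1 hne) (hp i hi) ?_
            rw [hij]
            exact hp j hj
          have hle : ((F.filter fun i => c ∈ u '' C i : Finset ι) : Set ι).encard ≤ k := by
            rw [← hinj.encard_image]
            refine (encard_le_encard ?_).trans (hfib c)
            rintro _ ⟨i, hi, rfl⟩
            exact ⟨hpc i hi, hCK i (Finset.mem_filter.1 hi).1 (hp i hi)⟩
          rw [encard_coe_eq_coe_finsetCard] at hle
          exact_mod_cast hle
        · have : ∀ i ∈ F, c ∉ u '' C i := fun i hi h => hc (image_mono (hCK i hi) h)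
          rw [Finset.sum_eq_zero fun i hi => indicator_of_notMem (this i hi) _]
          exact zero_le
    _ = k * volume (u '' K) := by
        rw [lintegral_const_mul _ (measurable_one.indicator hKmeas),
          lintegral_indicator_one hKmeas]

/-- The image of a continuous function on a preconnected set has length at least the distance
between any two values. -/
lemma ofReal_abs_sub_le_volume_image {X : Type*} [TopologicalSpace X] {C : Set X}
    (hC : IsPreconnected C) {u : X → ℝ} (hu : Continuous u) {x y : X} (hx : x ∈ C) (hy : y ∈ C) :
    ENNReal.ofReal |u x - u y| ≤ volume (u '' C) := by
  rw [abs_sub_comm, ← Real.volume_interval]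
  exact measure_mono ((hC.image u hu.continuousOn).ordConnected.uIcc_subset
    (mem_image_of_mem u hx) (mem_image_of_mem u hy))

/-- A curve whose fibres under two functions that jointly control the metric have at most `k`
points has finite 1-dimensional Hausdorff measure. -/
theorem hausdorffMeasure_one_image_lt_top {X : Type*} [MetricSpace X] [MeasurableSpace X]
    [BorelSpace X] {γ : ℝ → X} (hγ : ContinuousOn γ (Icc 0 1)) {u v : X → ℝ} (hu : Continuous u)
    (hv : Continuous v) {c : ℝ} (hc : 0 ≤ c)
    (huv : ∀ x y, dist x y ≤ c * (|u x - u y| + |v x - v y|)) {k : ℕ}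
    (hfu : ∀ d, ({x | u x = d} ∩ γ '' Icc 0 1).encard ≤ k)
    (hfv : ∀ d, ({x | v x = d} ∩ γ '' Icc 0 1).encard ≤ k) :
    Measure.hausdorffMeasure 1 (γ '' Icc 0 1) < ⊤ := by
  set K := γ '' Icc 0 1 with hKdef
  have hK : IsCompact K := isCompact_Icc.image_of_continuousOn hγ
  have hKu := hK.image hu
  have hKv := hK.image hv
  by_cases hsub : K.Subsingleton
  · exact (Measure.hausdorffMeasure_le_one_of_subsingleton hsub zero_le_one).trans_lt
      ENNReal.one_lt_top
  obtain ⟨p, hp, q, hq, hpq⟩ := not_subsingleton_iff.1 hsub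
  have hd : 0 < dist p q := dist_pos.2 hpq
  set M : ℝ≥0∞ := 3 * (ENNReal.ofReal c * (k * volume (u '' K) + k * volume (v '' K))) with hM
  have hMtop : M < ⊤ := by
    have := hKu.measure_lt_top (μ := volume)
    have := hKv.measure_lt_top (μ := volume)
    finiteness
  refine (hausdorffMeasure_one_le_of_card_separated_le hK (M := M) (ε₀ := nndist p q)
    (by exact_mod_cast hd) ?_).trans_lt (ENNReal.mul_lt_top (by simp) hMtop)
  intro ε hε hεle F hFK hFsep
  have hεle' : (ε : ℝ) ≤ dist p q := by exact_mod_cast hεle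
  have hε' : (0 : ℝ) < ε := by exact_mod_cast hε
  have hex : ∀ x ∈ F, ∃ C ⊆ K, IsCompact C ∧ IsPreconnected C ∧
      C ⊆ closedBall x (ε / 3) ∧ x ∈ C ∧ ∃ z ∈ C, dist z x = ε / 3 := by
    intro x hx
    obtain ⟨a, ha, rfl⟩ := hFK hx
    have hfar : ∃ y ∈ K, (ε / 3 : ℝ) ≤ dist y (γ a) := by
      by_contra! hcon
      have := dist_triangle_right p q (γ a)
      linarith [hcon p hp, hcon q hq]
    obtain ⟨_, ⟨b, hb, rfl⟩, hy⟩ := hfar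
    exact exists_subcontinuum_closedBall hγ ha hb (by positivity) hy
  choose! C hCK hCc hCp hCb hCx z hz hzx using hex
  have hdisj : (F : Set X).PairwiseDisjoint C := by
    intro x hx y hy hxy
    refine Disjoint.mono (hCb x hx) (hCb y hy) (closedBall_disjoint_closedBall ?_)
    have h1 : (ε : ℝ≥0∞) < edist x y := hFsep hx hy hxy
    rw [edist_nndist] at h1
    have h2 : (ε : ℝ) < dist x y := by exact_mod_cast h1
    linarith
  have hmu : ∀ x ∈ F, MeasurableSet (u '' C x) :=
    fun x hx => ((hCc x hx).image hu).isClosed.measurableSet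
  have hmv : ∀ x ∈ F, MeasurableSet (v '' C x) :=
    fun x hx => ((hCc x hx).image hv).isClosed.measurableSet
  have hpt : ∀ x ∈ F, (ε : ℝ≥0∞) ≤
      3 * (ENNReal.ofReal c * (volume (u '' C x) + volume (v '' C x))) := by
    intro x hx
    calc (ε : ℝ≥0∞) = ENNReal.ofReal (3 * dist (z x) x) := by
          rw [hzx x hx, mul_div_cancel₀ _ three_ne_zero, ENNReal.ofReal_coe_nnreal]
      _ ≤ ENNReal.ofReal (3 * (c * (|u (z x) - u x| + |v (z x) - v x|))) := by
          gcongr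
          exact huv _ _
      _ = 3 * (ENNReal.ofReal c *
            (ENNReal.ofReal |u (z x) - u x| + ENNReal.ofReal |v (z x) - v x|)) := by
          rw [ENNReal.ofReal_mul (by norm_num), ENNReal.ofReal_mul hc,
            ENNReal.ofReal_add (abs_nonneg _) (abs_nonneg _)]
          simp
      _ ≤ _ := by
          gcongr
          · exact ofReal_abs_sub_le_volume_image (hCp x hx) hu (hz x hx) (hCx x hx)
          · exact ofReal_abs_sub_le_volume_image (hCp x hx) hv (hz x hx) (hCx x hx)
  calc (F.card : ℝ≥0∞) * ε = ∑ x ∈ F, (ε : ℝ≥0∞) := by simp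
    _ ≤ ∑ x ∈ F, 3 * (ENNReal.ofReal c * (volume (u '' C x) + volume (v '' C x))) :=
        Finset.sum_le_sum hpt
    _ = 3 * (ENNReal.ofReal c *
          (∑ x ∈ F, volume (u '' C x) + ∑ x ∈ F, volume (v '' C x))) := by
        rw [← Finset.mul_sum, ← Finset.mul_sum, Finset.sum_add_distrib]
    _ ≤ M := by
        rw [hM]
        gcongr
        · exact sum_volume_image_le_of_fiber_encard_le hfu F C hCK hdisj hmu
            hKu.isClosed.measurableSet
        · exact sum_volume_image_le_of_fiber_encard_le hfv F C hCK hdisj hmv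
            hKv.isClosed.measurableSet

/-- A line `{p | Y p + m * X p = d}` in the rotated coordinates `X`, `Y` with `|m| = tan φ` lies in
a translate of the cone. -/
lemma exists_subset_rotConeAt {φ m : ℝ} (hm : Real.tan φ = |m|) (ρ d : ℝ) :
    ∃ P, {p : EuclideanSpace ℝ (Fin 2) | (-Real.sin ρ * p 0 + Real.cos ρ * p 1) +
      m * (Real.cos ρ * p 0 + Real.sin ρ * p 1) = d} ⊆ rotConeAt P φ ρ := by
  refine ⟨!₂[-Real.sin ρ * d, Real.cos ρ * d], fun p hp => ?_⟩
  simp only [mem_ofPred_eq] at hp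
  have h1 := Real.sin_sq_add_cos_sq ρ
  simp only [rotConeAt, rotCone, mem_ofPred_eq, hm, ← abs_mul]
  simp only [PiLp.sub_apply, Matrix.cons_val_zero, Matrix.cons_val_one]
  apply le_of_eq
  rw [← abs_neg]
  congr 1
  linear_combination (-1 : ℝ) * hp + d * h1

/-- If every admissible line (a line contained in some translate
`C_P(φ,ρ)` of the cone) meets the image of the continuous curve
`γ : [0,1] → ℝ²` in at most `k` points, then the image of `γ` is σ-finite with
respect to the 1-dimensional Hausdorff measure. -/
theorem stmt_5 (γ : ℝ → EuclideanSpace ℝ (Fin 2)) (hγ : ContinuousOn γ (Set.Icc 0 1))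
    (k : ℕ) (hk : 2 ≤ k) (φ ρ : ℝ) (hφ : φ ∈ Set.Ioo 0 (Real.pi / 2))
    (hρ : ρ ∈ Set.Ico 0 (2 * Real.pi))
    (hlines : ∀ L : Set (EuclideanSpace ℝ (Fin 2)), IsLine L →
      (∃ P : EuclideanSpace ℝ (Fin 2), L ⊆ rotConeAt P φ ρ) →
      (L ∩ γ '' Set.Icc 0 1).encard ≤ k) :
    ∃ s : ℕ → Set (EuclideanSpace ℝ (Fin 2)),
      (γ '' Set.Icc 0 1 = ⋃ n, s n) ∧
      ∀ n, MeasureTheory.Measure.hausdorffMeasure 1 (s n) < ⊤ := by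
  have ht : 0 < Real.tan φ := Real.tan_pos_of_pos_of_lt_pi_div_two hφ.1 hφ.2
  have h1 := Real.sin_sq_add_cos_sq ρ
  have hfib : ∀ m : ℝ, Real.tan φ = |m| → ∀ d : ℝ,
      ({p : EuclideanSpace ℝ (Fin 2) | (-Real.sin ρ * p 0 + Real.cos ρ * p 1) +
        m * (Real.cos ρ * p 0 + Real.sin ρ * p 1) = d} ∩ γ '' Set.Icc 0 1).encard ≤ k := by
    intro m hm d
    refine hlines _ ⟨-Real.sin ρ + m * Real.cos ρ, Real.cos ρ + m * Real.sin ρ, d, ?_, ?_⟩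
      (exists_subset_rotConeAt hm ρ d)
    · by_contra! hcon
      have : Real.sin ρ ^ 2 + Real.cos ρ ^ 2 = 0 := by
        linear_combination -Real.sin ρ * hcon.1 + Real.cos ρ * hcon.2
      linarith
    · ext p
      simp only [mem_ofPred_eq]
      ring_nf
  refine ⟨fun _ => γ '' Set.Icc 0 1, (iUnion_const _).symm, fun _ => ?_⟩
  refine hausdorffMeasure_one_image_lt_top hγ (c := 1 + (Real.tan φ)⁻¹) (by fun_prop) (by fun_prop)
    (by positivity) ?_ (hfib (Real.tan φ) (abs_of_pos ht).symm)
    (hfib (-Real.tan φ) (by rw [abs_neg, abs_of_pos ht]))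
  intro x y
  set t := Real.tan φ
  set X := Real.cos ρ * (x 0 - y 0) + Real.sin ρ * (x 1 - y 1) with hX
  set Y := -Real.sin ρ * (x 0 - y 0) + Real.cos ρ * (x 1 - y 1) with hY
  have hdist : dist x y ≤ |X| + |Y| := by
    rw [EuclideanSpace.dist_eq, Real.sqrt_le_left (by positivity)]
    simp only [Fin.sum_univ_two, Real.dist_eq, sq_abs]
    have : (x 0 - y 0) ^ 2 + (x 1 - y 1) ^ 2 = X ^ 2 + Y ^ 2 := by
      linear_combination -((x 0 - y 0) ^ 2 + (x 1 - y 1) ^ 2) * h1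
    rw [this, ← sq_abs X, ← sq_abs Y]
    nlinarith [mul_nonneg (abs_nonneg X) (abs_nonneg Y)]
  refine hdist.trans ?_
  rw [show -Real.sin ρ * x 0 + Real.cos ρ * x 1 + t * (Real.cos ρ * x 0 + Real.sin ρ * x 1) -
      (-Real.sin ρ * y 0 + Real.cos ρ * y 1 + t * (Real.cos ρ * y 0 + Real.sin ρ * y 1)) =
      Y + t * X by rw [hX, hY]; ring,
    show -Real.sin ρ * x 0 + Real.cos ρ * x 1 + -t * (Real.cos ρ * x 0 + Real.sin ρ * x 1) -
      (-Real.sin ρ * y 0 + Real.cos ρ * y 1 + -t * (Real.cos ρ * y 0 + Real.sin ρ * y 1)) =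
      Y - t * X by rw [hX, hY]; ring]
  set S := |Y + t * X| + |Y - t * X| with hS
  have hS0 : 0 ≤ S := by positivity
  have hYS : |Y| ≤ S := by
    have h := abs_add_le (Y + t * X) (Y - t * X)
    rw [show Y + t * X + (Y - t * X) = 2 * Y by ring, abs_mul, abs_two] at h
    linarith [abs_nonneg Y]
  have hXS : |X| ≤ t⁻¹ * S := by
    have h := abs_sub (Y + t * X) (Y - t * X)
    rw [show Y + t * X - (Y - t * X) = 2 * (t * X) by ring, abs_mul, abs_mul, abs_two,
      abs_of_pos ht] at h
    rw [le_inv_mul_iff₀ ht]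
    linarith [mul_nonneg ht.le (abs_nonneg X)]
  linarith
end

section
/- Let γ : [0,1] → ℝ² be a continuous curve, and fix an integer k ≥ 2, an angle φ ∈ (0, π/2) and a rotation ρ ∈ [0, 2π). Suppose that every admissible line (every line contained in C_P(φ,ρ) for some point P ∈ ℝ²) intersects the image of γ in at most k points. Then for every point P in the image of γ there exist θ ∈ (0, π/2), a rotation ρ′ and a radius h > 0 such that C(θ,ρ′) ⊆ C(φ,ρ) and the truncated cone C_P(θ,ρ′,h) intersects the image of γ only at P, i.e. C_P(θ,ρ′,h) ∩ γ = {P}. -/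
/-- The truncated cone `C_P(φ,ρ,h) = C_P(φ,ρ) ∩ B̄(P,h)`. -/
def rotConeAtTrunc (P : EuclideanSpace ℝ (Fin 2)) (φ ρ h : ℝ) :
    Set (EuclideanSpace ℝ (Fin 2)) :=
  rotConeAt P φ ρ ∩ Metric.closedBall P h

open Set Filter Topology

/-- The first coordinate of `p` in the orthonormal frame rotated by `ρ`. -/
noncomputable def rotFst (ρ : ℝ) (p : EuclideanSpace ℝ (Fin 2)) : ℝ :=
  Real.cos ρ * p 0 + Real.sin ρ * p 1

/-- The second coordinate of `p` in the orthonormal frame rotated by `ρ`. -/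
noncomputable def rotSnd (ρ : ℝ) (p : EuclideanSpace ℝ (Fin 2)) : ℝ :=
  (-Real.sin ρ) * p 0 + Real.cos ρ * p 1

theorem mem_rotCone {φ ρ : ℝ} {p : EuclideanSpace ℝ (Fin 2)} :
    p ∈ rotCone φ ρ ↔ Real.tan φ * |rotFst ρ p| ≤ |rotSnd ρ p| := Iff.rfl

theorem continuous_rotFst (ρ : ℝ) : Continuous (rotFst ρ) := by
  unfold rotFst; fun_prop

theorem continuous_rotSnd (ρ : ℝ) : Continuous (rotSnd ρ) := by
  unfold rotSnd; fun_prop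

theorem rotFst_sq_add_rotSnd_sq (ρ : ℝ) (p : EuclideanSpace ℝ (Fin 2)) :
    rotFst ρ p ^ 2 + rotSnd ρ p ^ 2 = ‖p‖ ^ 2 := by
  rw [EuclideanSpace.norm_sq_eq, Fin.sum_univ_two, Real.norm_eq_abs, Real.norm_eq_abs, sq_abs,
    sq_abs, rotFst, rotSnd]
  linear_combination (p 0 ^ 2 + p 1 ^ 2) * Real.sin_sq_add_cos_sq ρ

theorem abs_rotSnd_le_norm (ρ : ℝ) (p : EuclideanSpace ℝ (Fin 2)) : |rotSnd ρ p| ≤ ‖p‖ :=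
  abs_le_of_sq_le_sq (by nlinarith [rotFst_sq_add_rotSnd_sq ρ p, sq_nonneg (rotFst ρ p)])
    (norm_nonneg p)

theorem eq_zero_of_rotFst_rotSnd {ρ : ℝ} {p : EuclideanSpace ℝ (Fin 2)}
    (h₁ : rotFst ρ p = 0) (h₂ : rotSnd ρ p = 0) : p = 0 := by
  have := rotFst_sq_add_rotSnd_sq ρ p
  rw [h₁, h₂] at this
  exact norm_eq_zero.mp (pow_eq_zero_iff two_ne_zero |>.mp (by linarith))

theorem rotFst_sub_angle (ρ α : ℝ) (p : EuclideanSpace ℝ (Fin 2)) :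
    rotFst (ρ - α) p = Real.cos α * rotFst ρ p - Real.sin α * rotSnd ρ p := by
  simp only [rotFst, rotSnd, Real.cos_sub, Real.sin_sub]; ring

theorem rotSnd_sub_angle (ρ α : ℝ) (p : EuclideanSpace ℝ (Fin 2)) :
    rotSnd (ρ - α) p = Real.sin α * rotFst ρ p + Real.cos α * rotSnd ρ p := by
  simp only [rotFst, rotSnd, Real.cos_sub, Real.sin_sub]; ring

/-- Around every direction `(m, 1)` of the rotated frame there are arbitrarily thin cones. -/
theorem exists_rotCone_subset (ρ m : ℝ) {ε : ℝ} (hε : 0 < ε) :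
    ∃ θ ∈ Ioo (0 : ℝ) (Real.pi / 2), ∃ ρ' : ℝ, ∀ p ∈ rotCone θ ρ',
      |rotFst ρ p - m * rotSnd ρ p| ≤ ε * |rotSnd ρ p| := by
  set M := |m| + (1 + m ^ 2) / ε with hM
  have hMpos : 0 < M := by positivity
  refine ⟨Real.arctan M, ⟨Real.arctan_pos.mpr hMpos, Real.arctan_lt_pi_div_two M⟩,
    ρ - Real.arctan m, fun p hp => ?_⟩
  rw [mem_rotCone, Real.tan_arctan, rotFst_sub_angle, rotSnd_sub_angle] at hp
  set X := rotFst ρ p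
  set Y := rotSnd ρ p
  have hc := Real.cos_arctan_pos m
  have hs : Real.sin (Real.arctan m) = Real.cos (Real.arctan m) * m := by
    rw [← Real.tan_mul_cos hc.ne', Real.tan_arctan, mul_comm]
  set κ := Real.cos (Real.arctan m)
  have e₁ : κ * X - Real.sin (Real.arctan m) * Y = κ * (X - m * Y) := by rw [hs]; ring
  have e₂ : Real.sin (Real.arctan m) * X + κ * Y =
      κ * (m * (X - m * Y) + (1 + m ^ 2) * Y) := by rw [hs]; ring
  rw [e₁, e₂, abs_mul, abs_mul, abs_of_pos hc, mul_left_comm] at hp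
  have h₁ := le_of_mul_le_mul_left hp hc
  have h₂ := abs_add_le (m * (X - m * Y)) ((1 + m ^ 2) * Y)
  rw [abs_mul, abs_mul, abs_of_pos (by positivity : 0 < 1 + m ^ 2)] at h₂
  have h₃ : (1 + m ^ 2) / ε * |X - m * Y| ≤ (1 + m ^ 2) * |Y| := by
    rw [hM, add_mul] at h₁; linarith
  have h₄ : (1 + m ^ 2) * |X - m * Y| ≤ (1 + m ^ 2) * (ε * |Y|) := by
    rw [div_mul_eq_mul_div, div_le_iff₀ hε] at h₃; linarith
  exact le_of_mul_le_mul_left h₄ (by positivity)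

theorem isLine_rotFst_eq (P : EuclideanSpace ℝ (Fin 2)) (ρ u : ℝ) :
    IsLine {q | rotFst ρ (q - P) = u * rotSnd ρ (q - P)} := by
  refine ⟨Real.cos ρ + u * Real.sin ρ, Real.sin ρ - u * Real.cos ρ,
    (Real.cos ρ + u * Real.sin ρ) * P 0 + (Real.sin ρ - u * Real.cos ρ) * P 1, ?_, ?_⟩
  · by_contra! h
    have : 1 + u ^ 2 = 0 := by
      linear_combination (Real.cos ρ + u * Real.sin ρ) * h.1 +
        (Real.sin ρ - u * Real.cos ρ) * h.2 - (1 + u ^ 2) * Real.sin_sq_add_cos_sq ρ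
    nlinarith [sq_nonneg u]
  · ext q
    simp only [rotFst, rotSnd, mem_ofPred_eq, PiLp.sub_apply]
    constructor <;> intro h <;> linear_combination h

/-- A connected set is a point if a real function with finite fibres on it takes its values
inside `interior (closure F)` but avoids `F`. -/
theorem IsPreconnected.subsingleton_of_avoids {E : Type*} [TopologicalSpace E] [T1Space E]
    {S : Set E} (hS : IsPreconnected S) {r : E → ℝ} (hr : ContinuousOn r S) {F : Set ℝ}
    (hcl : ∀ q ∈ S, r q ∈ interior (closure F)) (havoid : ∀ q ∈ S, r q ∉ F)
    (hfin : ∀ q ∈ S, {q' ∈ S | r q' = r q}.Finite) : S.Subsingleton := by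
  have hlt : ∀ p ∈ S, ∀ q ∈ S, ¬ r p < r q := by
    intro p hp q hq hpq
    have hIcc : Icc (r p) (r q) ⊆ r '' S := hS.intermediate_value hp hq hr
    have hsub : (Ioo (r p) (r q) ∩ closure F).Nonempty := by
      obtain ⟨m, hm⟩ := nonempty_Ioo.mpr hpq
      obtain ⟨q', hq', rfl⟩ := hIcc (Ioo_subset_Icc_self hm)
      exact ⟨_, hm, interior_subset (hcl q' hq')⟩
    obtain ⟨y, hy, hyF⟩ := hsub
    obtain ⟨z, hz, hzF⟩ := mem_closure_iff.mp hyF _ isOpen_Ioo hy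
    obtain ⟨q', hq', rfl⟩ := hIcc (Ioo_subset_Icc_self hz)
    exact havoid q' hq' hzF
  by_contra hnt
  rw [not_subsingleton_iff] at hnt
  obtain ⟨p, hp⟩ := hnt.nonempty
  refine hS.infinite_of_nontrivial hnt ((hfin p hp).subset fun q hq => ⟨hq, ?_⟩)
  exact le_antisymm (not_lt.mp (hlt p hp q hq)) (not_lt.mp (hlt q hq p hp))

/-- A continuous map from a connected, locally connected space is constant if it meets an open
set `V` in which its range has only trivial connected subsets. -/
theorem Continuous.eq_of_preconnected_subsingleton {α E : Type*} [TopologicalSpace α]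
    [PreconnectedSpace α] [LocallyConnectedSpace α] [TopologicalSpace E] [T1Space E]
    {f : α → E} (hf : Continuous f) {V : Set E} (hV : IsOpen V)
    (hsub : ∀ S ⊆ range f ∩ V, IsPreconnected S → S.Subsingleton)
    {x : α} (hx : f x ∈ V) (y : α) : f y = f x := by
  have hopen : IsOpen (f ⁻¹' {f x}) := by
    rw [isOpen_iff_mem_nhds]
    intro z hz
    have hzx : f z = f x := hz
    have hzV : z ∈ f ⁻¹' V := by rw [mem_preimage, hzx]; exact hx
    have hzC : z ∈ connectedComponentIn (f ⁻¹' V) z := mem_connectedComponentIn hzV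
    filter_upwards [(hV.preimage hf).connectedComponentIn.mem_nhds hzC] with w hw
    have hs := hsub (f '' connectedComponentIn (f ⁻¹' V) z) (by
      rintro _ ⟨v, hv, rfl⟩
      exact ⟨mem_range_self v, (connectedComponentIn_subset _ _ hv : v ∈ f ⁻¹' V)⟩)
      (isPreconnected_connectedComponentIn.image _ hf.continuousOn)
    exact (hs (mem_image_of_mem f hw) (mem_image_of_mem f hzC)).trans hzx
  have := IsClopen.eq_univ ⟨isClosed_singleton.preimage hf, hopen⟩ ⟨x, rfl⟩
  exact this.ge (mem_univ y)

/-- Under the hypothesis that every admissible line meets the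
image of `γ` in at most `k` points, every point `P` of the image of `γ` admits
a truncated cone `C_P(θ,ρ',h)`, with `C(θ,ρ') ⊆ C(φ,ρ)`, meeting the image of
`γ` only at `P`. -/
theorem stmt_6 (γ : ℝ → EuclideanSpace ℝ (Fin 2)) (hγ : ContinuousOn γ (Set.Icc 0 1))
    (k : ℕ) (hk : 2 ≤ k) (φ ρ : ℝ) (hφ : φ ∈ Set.Ioo 0 (Real.pi / 2))
    (hρ : ρ ∈ Set.Ico 0 (2 * Real.pi))
    (hlines : ∀ L : Set (EuclideanSpace ℝ (Fin 2)), IsLine L →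
      (∃ P : EuclideanSpace ℝ (Fin 2), L ⊆ rotConeAt P φ ρ) →
      (L ∩ γ '' Set.Icc 0 1).encard ≤ k)
    (P : EuclideanSpace ℝ (Fin 2)) (hP : P ∈ γ '' Set.Icc 0 1) :
    ∃ θ ∈ Set.Ioo (0 : ℝ) (Real.pi / 2), ∃ ρ' h : ℝ, 0 < h ∧
      rotCone θ ρ' ⊆ rotCone φ ρ ∧
      rotConeAtTrunc P θ ρ' h ∩ γ '' Set.Icc 0 1 = {P} := by
  have ht : 0 < Real.tan φ := Real.tan_pos_of_pos_of_lt_pi_div_two hφ.1 hφ.2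
  set c := (Real.tan φ)⁻¹ with hc
  have hcpos : 0 < c := inv_pos.mpr ht
  set K := γ '' Icc 0 1
  let X : EuclideanSpace ℝ (Fin 2) → ℝ := fun q => rotFst ρ (q - P)
  let Y : EuclideanSpace ℝ (Fin 2) → ℝ := fun q => rotSnd ρ (q - P)
  have hX : Continuous X := (continuous_rotFst ρ).comp (by fun_prop)
  have hY : Continuous Y := (continuous_rotSnd ρ).comp (by fun_prop)
  have hcone : ∀ p, |rotFst ρ p| ≤ c * |rotSnd ρ p| → p ∈ rotCone φ ρ := by
    intro p hp
    rw [mem_rotCone]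
    rwa [hc, inv_mul_eq_div, le_div_iff₀ ht, mul_comm] at hp
  have hfinite : ∀ u : ℝ, |u| ≤ c → {q ∈ K | X q = u * Y q}.Finite := by
    intro u hu
    have := hlines _ (isLine_rotFst_eq P ρ u) ⟨P, fun q hq => hcone _ (by
      rw [show rotFst ρ (q - P) = _ from hq, abs_mul]
      gcongr)⟩
    exact (finite_of_encard_le_coe this).subset fun q hq => ⟨hq.2, hq.1⟩
  let F : ℕ → Set ℝ := fun n =>
    {u | |u| ≤ c → ∀ q ∈ K, X q = u * Y q → |Y q| < 1 / ((n : ℝ) + 1) → Y q = 0}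
  have hcover : ⋃ n, closure (F n) = univ := by
    refine eq_univ_of_forall fun u => ?_
    suffices ∃ n, u ∈ F n by
      obtain ⟨n, hn⟩ := this
      exact mem_iUnion.mpr ⟨n, subset_closure hn⟩
    by_cases hu : |u| ≤ c
    · have : ∀ᶠ n : ℕ in atTop, ∀ q ∈ {q ∈ K | X q = u * Y q},
          |Y q| < 1 / ((n : ℝ) + 1) → Y q = 0 := by
        rw [eventually_all_finite (hfinite u hu)]
        intro q _
        by_cases hq : Y q = 0
        · exact Eventually.of_forall fun _ _ => hq
        · filter_upwards [tendsto_one_div_add_atTop_nhds_zero_nat.eventually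
            (gt_mem_nhds (abs_pos.mpr hq))] with n hn hn'
          exact absurd hn' hn.not_gt
      obtain ⟨n, hn⟩ := this.exists
      exact ⟨n, fun _ q hqK hq => hn q ⟨hqK, hq⟩⟩
    · exact ⟨0, fun h => absurd h hu⟩
  obtain ⟨m, hmc, hm⟩ := (dense_iUnion_interior_of_closed
    (fun n => isClosed_closure (s := F n)) hcover).inter_open_nonempty (Ioo (-c) c) isOpen_Ioo
    (nonempty_Ioo.mpr (by linarith))
  obtain ⟨n, hn⟩ := mem_iUnion.mp hm
  set δ : ℝ := 1 / ((n : ℝ) + 1)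
  have hδpos : 0 < δ := by positivity
  set W := interior (closure (F n)) ∩ Ioo (-c) c
  have hWo : IsOpen W := isOpen_interior.inter isOpen_Ioo
  obtain ⟨ε, hε, hεW⟩ := Metric.nhds_basis_closedBall.mem_iff.mp (hWo.mem_nhds ⟨hn, hmc⟩)
  set V : Set (EuclideanSpace ℝ (Fin 2)) :=
    {q | Y q ≠ 0 ∧ |Y q| < δ} ∩ (fun q => X q / Y q) ⁻¹' W
  have hr : ContinuousOn (fun q => X q / Y q) {q | Y q ≠ 0 ∧ |Y q| < δ} :=
    hX.continuousOn.div hY.continuousOn fun q hq => hq.1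
  have hVo : IsOpen V := hr.isOpen_inter_preimage
    ((isOpen_ne_fun hY continuous_const).inter (isOpen_lt hY.abs continuous_const)) hWo
  have hdisj : ∀ q ∈ K, q ∉ V := by
    rintro _ ⟨s, hs, rfl⟩ hqV
    obtain ⟨t, htI, rfl⟩ := hP
    have hrange : range ((Icc (0 : ℝ) 1).domRestrict γ) = K := range_domRestrict _ _
    have : LocallyConnectedSpace (Icc (0 : ℝ) 1) :=
      (isQuotientMap_projIcc (h := zero_le_one)).isCoinducing.locallyConnectedSpace
    have key := (continuousOn_iff_continuous_domRestrict.mp hγ).eq_of_preconnected_subsingleton hVo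
      (x := ⟨s, hs⟩) (fun S hS hSc => ?_) hqV ⟨t, htI⟩
    · have hst : γ t = γ s := key
      refine hqV.1.1 ?_
      simp [Y, ← hst, rotSnd]
    · rw [hrange] at hS
      refine hSc.subsingleton_of_avoids (F := F n) (hr.mono fun q hq => (hS hq).2.1)
        (fun q hq => (hS hq).2.2.1) (fun q hq hqF => ?_) (fun q hq => ?_)
      · obtain ⟨hqK, ⟨hY0, hYδ⟩, -, hqc⟩ := hS hq
        exact hY0 (hqF (abs_le.mpr ⟨hqc.1.le, hqc.2.le⟩) q hqK (div_mul_cancel₀ _ hY0).symm hYδ)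
      · obtain ⟨-, -, -, hqc⟩ := hS hq
        refine (hfinite _ (abs_le.mpr ⟨hqc.1.le, hqc.2.le⟩)).subset fun q' hq' => ?_
        have h' := hS hq'.1
        refine ⟨h'.1, ?_⟩
        change X q' = X q / Y q * Y q'
        rw [← hq'.2]
        exact (div_mul_cancel₀ _ h'.2.1.1).symm
  obtain ⟨θ, hθ, ρ', hthin⟩ := exists_rotCone_subset ρ m hε
  have hslope : ∀ p ∈ rotCone θ ρ', rotSnd ρ p ≠ 0 → rotFst ρ p / rotSnd ρ p ∈ W := by
    intro p hp h0
    apply hεW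
    rw [Metric.mem_closedBall, Real.dist_eq, div_sub' h0, abs_div,
      div_le_iff₀ (abs_pos.mpr h0), mul_comm (rotSnd ρ p)]
    exact hthin p hp
  have hzero : ∀ p ∈ rotCone θ ρ', rotSnd ρ p = 0 → p = 0 := by
    intro p hp h0
    have := hthin p hp
    rw [h0, mul_zero, sub_zero, abs_zero, mul_zero] at this
    exact eq_zero_of_rotFst_rotSnd (abs_nonpos_iff.mp this) h0
  refine ⟨θ, hθ, ρ', δ / 2, by positivity, fun p hp => hcone p ?_, ?_⟩
  · by_cases h0 : rotSnd ρ p = 0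
    · rw [hzero p hp h0]; simp [rotFst, rotSnd]
    · have h := (hslope p hp h0).2
      rw [← div_le_iff₀ (abs_pos.mpr h0), ← abs_div]
      exact abs_le.mpr ⟨h.1.le, h.2.le⟩
  · ext q
    rw [mem_singleton_iff]
    constructor
    · rintro ⟨⟨hq, hqh⟩, hqK⟩
      by_contra hne
      have h0 : Y q ≠ 0 := fun h => hne (sub_eq_zero.mp (hzero _ hq h))
      refine hdisj q hqK ⟨⟨h0, ?_⟩, hslope _ hq h0⟩
      have h₁ : |Y q| ≤ ‖q - P‖ := abs_rotSnd_le_norm ρ _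
      rw [Metric.mem_closedBall, dist_eq_norm] at hqh
      linarith
    · rintro rfl
      refine ⟨⟨?_, Metric.mem_closedBall_self (by positivity)⟩, hP⟩
      simp [rotConeAt, rotCone]
end

section
/- Let γ : [0,1] → ℝ² be a continuous curve, and fix an integer k ≥ 2, an angle φ ∈ (0, π/2) and a rotation ρ ∈ [0, 2π). Suppose that every admissible line (every line contained in C_P(φ,ρ) for some point P ∈ ℝ²) intersects the image of γ in at most k points. Then for any point P ∈ ℝ² (not necessarily on the curve), the set C_P(φ,ρ) ∩ γ has only finitely many connected components, and in fact at most 2k of them. -/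
/-- The signed height `|v| - tan φ * |u|` of a point over the boundary of the cone `C(φ,ρ)`, where
`u` and `v` are the coordinates of the point in the rotated frame. -/
noncomputable def coneHeight (φ ρ : ℝ) (p : EuclideanSpace ℝ (Fin 2)) : ℝ :=
  |(-Real.sin ρ) * p 0 + Real.cos ρ * p 1| - Real.tan φ * |Real.cos ρ * p 0 + Real.sin ρ * p 1|

theorem continuous_coneHeight (φ ρ : ℝ) : Continuous (coneHeight φ ρ) := by
  unfold coneHeight
  fun_prop

theorem mem_rotConeAt_iff_coneHeight_nonneg {P q : EuclideanSpace ℝ (Fin 2)} {φ ρ : ℝ} :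
    q ∈ rotConeAt P φ ρ ↔ 0 ≤ coneHeight φ ρ (q - P) := by
  simp only [rotConeAt, rotCone, coneHeight, Set.mem_ofPred_eq, sub_nonneg]

/-- The line through `P` of slope `t` in the frame rotated by `ρ`. -/
def rotLine (P : EuclideanSpace ℝ (Fin 2)) (ρ t : ℝ) : Set (EuclideanSpace ℝ (Fin 2)) :=
  {q | (-Real.sin ρ) * (q - P) 0 + Real.cos ρ * (q - P) 1 =
    t * (Real.cos ρ * (q - P) 0 + Real.sin ρ * (q - P) 1)}

theorem isLine_rotLine (P : EuclideanSpace ℝ (Fin 2)) (ρ t : ℝ) : IsLine (rotLine P ρ t) := by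
  refine ⟨-Real.sin ρ - t * Real.cos ρ, Real.cos ρ - t * Real.sin ρ,
    (-Real.sin ρ - t * Real.cos ρ) * P 0 + (Real.cos ρ - t * Real.sin ρ) * P 1, ?_, ?_⟩
  · by_contra! h
    nlinarith [Real.sin_sq_add_cos_sq ρ, sq_nonneg t, congrArg (Real.sin ρ * ·) h.1,
      congrArg (Real.cos ρ * ·) h.2]
  · ext q
    simp only [rotLine, Set.mem_ofPred_eq, PiLp.sub_apply]
    constructor <;> intro h <;> linarith

theorem rotLine_subset_rotConeAt (P : EuclideanSpace ℝ (Fin 2)) {φ ρ t : ℝ}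
    (ht : Real.tan φ ≤ |t|) : rotLine P ρ t ⊆ rotConeAt P φ ρ := by
  intro q hq
  simp only [rotLine, Set.mem_ofPred_eq] at hq
  simp only [rotConeAt, rotCone, Set.mem_ofPred_eq, hq, abs_mul]
  gcongr

theorem mem_rotLine_of_coneHeight_eq_zero {P q : EuclideanSpace ℝ (Fin 2)} {φ ρ : ℝ}
    (hφ : 0 ≤ Real.tan φ) (hq : coneHeight φ ρ (q - P) = 0) :
    q ∈ rotLine P ρ (Real.tan φ) ∪ rotLine P ρ (-Real.tan φ) := by
  have h := sub_eq_zero.1 hq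
  nth_rw 1 [← abs_of_nonneg hφ] at h
  rw [← abs_mul, abs_eq_abs, ← neg_mul] at h
  exact h

/-- A continuous function which is nonnegative at `s` and negative at `r` has a zero `τ` between
`s` and `r` such that it stays nonnegative between `s` and `τ`. -/
theorem ContinuousOn.exists_eq_zero_forall_nonneg {f : ℝ → ℝ} {s r : ℝ}
    (hf : ContinuousOn f (Set.uIcc s r)) (hs : 0 ≤ f s) (hr : f r < 0) :
    ∃ τ ∈ Set.uIcc s r, f τ = 0 ∧ ∀ σ ∈ Set.uIcc s τ, 0 ≤ f σ := by
  have hz : ∀ σ ∈ Set.uIcc s r, f σ < 0 → ∃ z ∈ Set.uIcc s σ, f z = 0 := fun σ hσ hneg ↦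
    intermediate_value_uIcc (hf.mono (Set.uIcc_subset_uIcc_left hσ))
      (Set.mem_uIcc_of_ge hneg.le hs)
  have hc : IsCompact (Set.uIcc s r ∩ f ⁻¹' {0}) :=
    isCompact_uIcc.of_isClosed_subset
      (hf.preimage_isClosed_of_isClosed isCompact_uIcc.isClosed isClosed_singleton)
      Set.inter_subset_left
  obtain ⟨z, hz₁, hz₂⟩ := hz r Set.right_mem_uIcc hr
  obtain ⟨τ, ⟨hτ, hτ₀⟩, hmin⟩ := hc.exists_isMinOn ⟨z, hz₁, hz₂⟩
    (f := fun x ↦ |x - s|) (by fun_prop)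
  refine ⟨τ, hτ, hτ₀, fun σ hσ ↦ ?_⟩
  by_contra! hneg
  have hσ' : σ ∈ Set.uIcc s r := Set.uIcc_subset_uIcc_left hτ hσ
  obtain ⟨w, hw, hw₀⟩ := hz σ hσ' hneg
  have h₁ : |τ - s| ≤ |w - s| := hmin ⟨Set.uIcc_subset_uIcc_left hσ' hw, hw₀⟩
  have h₂ : |w - s| ≤ |σ - s| := Set.abs_sub_left_of_mem_uIcc hw
  have hστ : σ = τ := by
    rcases Set.mem_uIcc.1 hσ with h | h <;> grind
  rw [hστ] at hneg
  exact hneg.ne hτ₀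

/-- Under the hypothesis that every admissible line meets the
image of `γ` in at most `k` points, for any point `P` of the plane the set
`C_P(φ,ρ) ∩ γ` has finitely many connected components, in fact at most `2k`. -/
theorem stmt_7 (γ : ℝ → EuclideanSpace ℝ (Fin 2)) (hγ : ContinuousOn γ (Set.Icc 0 1))
    (k : ℕ) (hk : 2 ≤ k) (φ ρ : ℝ) (hφ : φ ∈ Set.Ioo 0 (Real.pi / 2))
    (hρ : ρ ∈ Set.Ico 0 (2 * Real.pi))
    (hlines : ∀ L : Set (EuclideanSpace ℝ (Fin 2)), IsLine L →
      (∃ P : EuclideanSpace ℝ (Fin 2), L ⊆ rotConeAt P φ ρ) →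
      (L ∩ γ '' Set.Icc 0 1).encard ≤ k)
    (P : EuclideanSpace ℝ (Fin 2)) :
    {C : Set (EuclideanSpace ℝ (Fin 2)) |
        ∃ x ∈ rotConeAt P φ ρ ∩ γ '' Set.Icc 0 1,
          C = connectedComponentIn (rotConeAt P φ ρ ∩ γ '' Set.Icc 0 1) x}.Finite ∧
    {C : Set (EuclideanSpace ℝ (Fin 2)) |
        ∃ x ∈ rotConeAt P φ ρ ∩ γ '' Set.Icc 0 1,
          C = connectedComponentIn (rotConeAt P φ ρ ∩ γ '' Set.Icc 0 1) x}.encard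
      ≤ 2 * k := by
  have ht : 0 ≤ Real.tan φ := (Real.tan_pos_of_pos_of_lt_pi_div_two hφ.1 hφ.2).le
  set K := γ '' Set.Icc 0 1 with hK
  set F := rotConeAt P φ ρ ∩ K with hF
  suffices h : {C | ∃ x ∈ F, C = connectedComponentIn F x}.encard ≤ 2 * k from
    ⟨Set.finite_of_encard_le_coe (k := 2 * k) (by exact_mod_cast h), h⟩
  by_cases hsub : K ⊆ rotConeAt P φ ρ
  · have hFK : F = K := Set.inter_eq_right.2 hsub
    have hconn : IsPreconnected F := hFK ▸ isPreconnected_Icc.image γ hγ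
    calc {C | ∃ x ∈ F, C = connectedComponentIn F x}.encard
        ≤ ({F} : Set (Set (EuclideanSpace ℝ (Fin 2)))).encard := by
          refine Set.encard_le_encard ?_
          rintro C ⟨x, hx, rfl⟩
          exact hconn.connectedComponentIn hx
      _ = 1 := Set.encard_singleton _
      _ ≤ 2 * k := by exact_mod_cast (by omega : 1 ≤ 2 * k)
  · obtain ⟨_, ⟨r, hr, rfl⟩, hrP⟩ := Set.not_subset.1 hsub
    rw [mem_rotConeAt_iff_coneHeight_nonneg, not_le] at hrP
    have hline : ∀ t : ℝ, Real.tan φ ≤ |t| → (rotLine P ρ t ∩ K).encard ≤ k := fun t h ↦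
      hlines _ (isLine_rotLine P ρ t) ⟨P, rotLine_subset_rotConeAt P h⟩
    calc {C | ∃ x ∈ F, C = connectedComponentIn F x}.encard
        ≤ (connectedComponentIn F '' ((rotLine P ρ (Real.tan φ) ∩ K) ∪
            (rotLine P ρ (-Real.tan φ) ∩ K))).encard := by
          refine Set.encard_le_encard ?_
          rintro _ ⟨_, ⟨hxP, s, hs, rfl⟩, rfl⟩
          have hsr : Set.uIcc s r ⊆ Set.Icc 0 1 := Set.uIcc_subset_Icc hs hr
          obtain ⟨τ, hτ, hτ₀, hnonneg⟩ := ContinuousOn.exists_eq_zero_forall_nonneg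
            (f := fun σ ↦ coneHeight φ ρ (γ σ - P))
            ((continuous_coneHeight φ ρ).comp_continuousOn
              ((hγ.mono hsr).sub continuousOn_const))
            (mem_rotConeAt_iff_coneHeight_nonneg.1 hxP) hrP
          have hsτ : Set.uIcc s τ ⊆ Set.Icc 0 1 := Set.uIcc_subset_Icc hs (hsr hτ)
          refine ⟨γ τ, ?_, ?_⟩
          · rw [← Set.union_inter_distrib_right]
            exact ⟨mem_rotLine_of_coneHeight_eq_zero ht hτ₀, τ, hsr hτ, rfl⟩
          · refine (connectedComponentIn_eq ?_).symm
            refine (isPreconnected_uIcc.image γ (hγ.mono hsτ)).subset_connectedComponentIn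
              ⟨s, Set.left_mem_uIcc, rfl⟩ ?_ ⟨τ, Set.right_mem_uIcc, rfl⟩
            rintro _ ⟨σ, hσ, rfl⟩
            exact ⟨mem_rotConeAt_iff_coneHeight_nonneg.2 (hnonneg σ hσ), σ, hsτ hσ, rfl⟩
      _ ≤ _ := Set.encard_image_le _ _
      _ ≤ _ := Set.encard_union_le _ _
      _ ≤ k + k := add_le_add (hline _ (le_abs_self _))
          (hline _ (by rw [abs_neg]; exact le_abs_self _))
      _ = 2 * k := (two_mul _).symm
end

section
/- Let γ : [0,1] → ℝ² be a continuous curve whose image is contained in the unit square [0,1]² and contains the points (0,0) and (1,1). Fix an integer k ≥ 2 and φ ∈ (0, π/2), and suppose every line contained in C_P(φ,0) for some point P intersects the image of γ in at most k points. Let θ ∈ [φ, π/2) and h > 0, and define γ′ = {P ∈ γ : C_P(θ,0,h) ∩ γ = {P}}. Then the 1-dimensional Hausdorff measure of γ′ satisfies H¹(γ′) ≤ 2k / cos(θ). -/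
open MeasureTheory Set

/-- Points of a compact set that are isolated from the rest of it by the truncated cone form a
Borel set. -/
theorem measurableSet_setOf_rotConeAtTrunc_inter_eq_singleton
    {K : Set (EuclideanSpace ℝ (Fin 2))} (hK : IsCompact K) (θ : ℝ) {h : ℝ} (hh : 0 < h) :
    MeasurableSet {P ∈ K | rotConeAtTrunc P θ 0 h ∩ K = {P}} := by
  let S : ℕ → Set (EuclideanSpace ℝ (Fin 2) × EuclideanSpace ℝ (Fin 2)) := fun n =>
    {z | 1 / ((n : ℝ) + 1) ≤ dist z.1 z.2 ∧ z.2 ∈ rotConeAtTrunc z.1 θ 0 h}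
  have hS : ∀ n, IsClosed (S n) := by
    intro n
    have h1 : IsClosed {z : EuclideanSpace ℝ (Fin 2) × EuclideanSpace ℝ (Fin 2) |
        1 / ((n : ℝ) + 1) ≤ dist z.1 z.2} := isClosed_le (by fun_prop) (by fun_prop)
    have h2 : IsClosed {z : EuclideanSpace ℝ (Fin 2) × EuclideanSpace ℝ (Fin 2) |
        z.2 ∈ rotConeAt z.1 θ 0} := by
      simp only [rotConeAt, rotCone, mem_ofPred_eq]
      exact isClosed_le (by fun_prop) (by fun_prop)
    have h3 : IsClosed {z : EuclideanSpace ℝ (Fin 2) × EuclideanSpace ℝ (Fin 2) |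
        dist z.2 z.1 ≤ h} := isClosed_le (by fun_prop) (by fun_prop)
    exact h1.inter (h2.inter h3)
  have key : {P ∈ K | rotConeAtTrunc P θ 0 h ∩ K = {P}} =
      K \ ⋃ n, Prod.fst '' (K ×ˢ K ∩ S n) := by
    ext P
    simp only [mem_ofPred_eq, mem_sdiff, mem_iUnion, not_exists]
    refine and_congr_right fun hP => ⟨?_, fun H => ?_⟩
    · rintro H n ⟨⟨P', Q⟩, ⟨⟨-, hQ⟩, hd, hc⟩, rfl⟩
      have hQP : Q ∈ ({P'} : Set (EuclideanSpace ℝ (Fin 2))) := H ▸ ⟨hc, hQ⟩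
      obtain rfl : Q = P' := hQP
      simp only [dist_self] at hd
      exact absurd hd (not_le.2 (by positivity))
    · refine Subset.antisymm ?_ ?_
      · rintro Q ⟨hc, hQ⟩
        by_contra hne
        obtain ⟨n, hn⟩ := exists_nat_one_div_lt (dist_pos.2 (Ne.symm hne))
        exact H n ⟨(P, Q), ⟨⟨hP, hQ⟩, hn.le, hc⟩, rfl⟩
      · rintro Q rfl
        refine ⟨⟨?_, Metric.mem_closedBall_self hh.le⟩, hP⟩
        simp [rotConeAt, rotCone]
  rw [key]
  exact hK.isClosed.measurableSet.diff (MeasurableSet.iUnion fun n =>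
    (((hK.prod hK).inter_right (hS n)).image continuous_fst).isClosed.measurableSet)

/-- If a continuous function is injective on each of countably many disjoint Borel sets, and its
fibres in their union have at most `k` points, the measures of the images add up to at most
`k` times the measure of any set containing them. -/
theorem tsum_volume_image_le {X : Type*} [TopologicalSpace X] [PolishSpace X]
    [MeasurableSpace X] [BorelSpace X] {f : X → ℝ} (hf : Continuous f) {A : ℕ → Set X}
    (hA : ∀ n, MeasurableSet (A n)) (hdisj : Pairwise fun i j => Disjoint (A i) (A j))
    (hinj : ∀ n, InjOn f (A n)) {k : ℕ} (hk : ∀ x, (f ⁻¹' {x} ∩ ⋃ n, A n).encard ≤ k)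
    {I : Set ℝ} (hI : MeasurableSet I) (hAI : ∀ n, MapsTo f (A n) I) :
    ∑' n, volume (f '' A n) ≤ k * volume I := by
  have hm : ∀ n, MeasurableSet (f '' A n) := fun n =>
    (hA n).image_of_continuousOn_injOn hf.continuousOn (hinj n)
  calc ∑' n, volume (f '' A n)
      = ∑' n, ∫⁻ x, (f '' A n).indicator 1 x := by
        simp_rw [lintegral_indicator_one (hm _)]
    _ = ∫⁻ x, ∑' n, (f '' A n).indicator 1 x :=
        (lintegral_tsum fun n => (measurable_one.indicator (hm n)).aemeasurable).symm
    _ ≤ ∫⁻ x, I.indicator (fun _ => (k : ENNReal)) x := by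
        refine lintegral_mono fun x => ?_
        by_cases hx : x ∈ I
        · rw [indicator_of_mem hx]
          refine ENNReal.summable.tsum_le_of_sum_le fun s => ?_
          classical
          have hsum : ∑ n ∈ s, (f '' A n).indicator (1 : ℝ → ENNReal) x =
              ((s.filter fun n => x ∈ f '' A n).card : ENNReal) := by
            simp [indicator_apply]
          rw [hsum, Nat.cast_le]
          have hmem : ∀ n : s.filter (fun n => x ∈ f '' A n), ∃ p, p ∈ A n ∧ f p = x :=
            fun n => (Finset.mem_filter.1 n.2).2
          choose p hpA hpx using hmem
          have hp : Function.Injective p := fun i j hij => by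
            by_contra hne
            exact (hdisj fun h => hne (Subtype.ext h)).le_bot ⟨hpA i, hij ▸ hpA j⟩
          have hle : (range p).encard ≤ k := by
            refine (encard_le_encard ?_).trans (hk x)
            rintro _ ⟨n, rfl⟩
            exact ⟨hpx n, mem_iUnion.2 ⟨n, hpA n⟩⟩
          rw [← image_univ, hp.encard_image, encard_univ, ENat.card_eq_coe_fintype_card,
            Fintype.card_coe] at hle
          exact_mod_cast hle
        · have : ∀ n, x ∉ f '' A n := by
            rintro n ⟨p, hp, rfl⟩
            exact hx (hAI n hp)
          simp [indicator_of_notMem, this]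
    _ = k * volume I := by rw [lintegral_indicator_const hI]

theorem dist_le_of_notMem_rotConeAt {θ : ℝ} (hθ : 0 < Real.cos θ)
    {P Q : EuclideanSpace ℝ (Fin 2)} (hQ : Q ∉ rotConeAt P θ 0) :
    dist Q P ≤ (Real.cos θ)⁻¹ * dist (Q 0) (P 0) := by
  simp only [rotConeAt, rotCone, mem_ofPred_eq, Real.cos_zero, Real.sin_zero, one_mul, zero_mul,
    neg_zero, add_zero, zero_add, PiLp.sub_apply, not_le, Real.tan_eq_sin_div_cos] at hQ
  rw [EuclideanSpace.dist_eq, Fin.sum_univ_two, Real.dist_eq, Real.dist_eq]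
  refine Real.sqrt_le_iff.2 ⟨by positivity, ?_⟩
  rw [div_mul_eq_mul_div, lt_div_iff₀ hθ] at hQ
  rw [← div_eq_inv_mul, div_pow, le_div_iff₀ (by positivity)]
  have h1 := pow_le_pow_left₀ (by positivity) hQ.le 2
  rw [mul_pow, mul_pow] at h1
  nlinarith [Real.sin_sq_add_cos_sq θ]

/-- Let `γ` be a continuous curve contained in the unit square and
passing through `(0,0)` and `(1,1)`, such that every line contained in some
vertical cone `C_P(φ,0)` meets the image of `γ` in at most `k` points. Then for
`θ ∈ [φ, π/2)` and `h > 0`, the set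
`γ' = {P ∈ γ : C_P(θ,0,h) ∩ γ = {P}}` satisfies `H¹(γ') ≤ 2k / cos θ`. -/
theorem stmt_8 (γ : ℝ → EuclideanSpace ℝ (Fin 2)) (hγ : ContinuousOn γ (Set.Icc 0 1))
    (hsq : ∀ t ∈ Set.Icc (0 : ℝ) 1, γ t 0 ∈ Set.Icc (0 : ℝ) 1 ∧ γ t 1 ∈ Set.Icc (0 : ℝ) 1)
    (h00 : ∃ t ∈ Set.Icc (0 : ℝ) 1, γ t 0 = 0 ∧ γ t 1 = 0)
    (h11 : ∃ t ∈ Set.Icc (0 : ℝ) 1, γ t 0 = 1 ∧ γ t 1 = 1)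
    (k : ℕ) (hk : 2 ≤ k) (φ : ℝ) (hφ : φ ∈ Set.Ioo 0 (Real.pi / 2))
    (hlines : ∀ L : Set (EuclideanSpace ℝ (Fin 2)), IsLine L →
      (∃ P : EuclideanSpace ℝ (Fin 2), L ⊆ rotConeAt P φ 0) →
      (L ∩ γ '' Set.Icc 0 1).encard ≤ k)
    (θ : ℝ) (hθ : θ ∈ Set.Ico φ (Real.pi / 2)) (h : ℝ) (hh : 0 < h) :
    MeasureTheory.Measure.hausdorffMeasure 1
        {P ∈ γ '' Set.Icc 0 1 | rotConeAtTrunc P θ 0 h ∩ γ '' Set.Icc 0 1 = {P}}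
      ≤ ENNReal.ofReal (2 * k / Real.cos θ) := by
  set K := γ '' Icc 0 1
  have hK : IsCompact K := isCompact_Icc.image_of_continuousOn hγ
  set G := {P ∈ K | rotConeAtTrunc P θ 0 h ∩ K = {P}}
  have hcos : 0 < Real.cos θ :=
    Real.cos_pos_of_mem_Ioo ⟨by linarith [hφ.1, hθ.1, Real.pi_pos], hθ.2⟩
  let B : ℕ → Set (EuclideanSpace ℝ (Fin 2)) :=
    disjointed fun n => Metric.ball (TopologicalSpace.denseSeq _ n) (h / 2)
  let A : ℕ → Set (EuclideanSpace ℝ (Fin 2)) := fun n => G ∩ B n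
  have hAm : ∀ n, MeasurableSet (A n) := fun n =>
    (measurableSet_setOf_rotConeAtTrunc_inter_eq_singleton hK θ hh).inter
      (MeasurableSet.disjointed (fun _ => measurableSet_ball) n)
  have hAu : ⋃ n, A n = G := by
    rw [← inter_iUnion, iUnion_disjointed, inter_eq_left]
    intro p _
    obtain ⟨n, hn⟩ := (TopologicalSpace.denseRange_denseSeq
      (EuclideanSpace ℝ (Fin 2))).exists_dist_lt p (half_pos hh)
    exact mem_iUnion.2 ⟨n, hn⟩
  have hAd : Pairwise fun i j => Disjoint (A i) (A j) := fun i j hij =>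
    (disjoint_disjointed _ hij).mono inter_subset_right inter_subset_right
  have hdist : ∀ n, ∀ P ∈ A n, ∀ Q ∈ A n,
      dist Q P ≤ (Real.cos θ)⁻¹ * dist (Q 0) (P 0) := by
    rintro n P ⟨hP, hPB⟩ Q ⟨hQ, hQB⟩
    rcases eq_or_ne Q P with rfl | hne
    · simp
    refine dist_le_of_notMem_rotConeAt hcos fun hc => hne ?_
    have hPb := disjointed_subset _ _ hPB
    have hQb := disjointed_subset _ _ hQB
    rw [Metric.mem_ball] at hPb hQb
    have hQP : dist Q P ≤ h := by
      have := dist_triangle_right Q P (TopologicalSpace.denseSeq (EuclideanSpace ℝ (Fin 2)) n)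
      linarith
    have : Q ∈ rotConeAtTrunc P θ 0 h ∩ K := ⟨⟨hc, Metric.mem_closedBall.2 hQP⟩, hQ.1⟩
    rwa [hP.2] at this
  let f : EuclideanSpace ℝ (Fin 2) → ℝ := fun p => p 0
  have hf : Continuous f := by fun_prop
  have hinj : ∀ n, InjOn f (A n) := by
    intro n Q hQ P hP hQP
    have hQP' : Q 0 = P 0 := hQP
    have := hdist n P hP Q hQ
    rw [hQP', dist_self, mul_zero] at this
    exact dist_le_zero.1 this
  have hvol : ∀ n, Measure.hausdorffMeasure 1 (A n) ≤
      ENNReal.ofReal (Real.cos θ)⁻¹ * volume (f '' A n) := by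
    intro n
    have hL : LipschitzOnWith (Real.cos θ)⁻¹.toNNReal (Function.invFunOn f (A n)) (f '' A n) := by
      refine LipschitzOnWith.of_dist_le_mul ?_
      rintro _ ⟨P, hP, rfl⟩ _ ⟨Q, hQ, rfl⟩
      rw [(hinj n).leftInvOn_invFunOn hP, (hinj n).leftInvOn_invFunOn hQ,
        Real.coe_toNNReal _ (by positivity)]
      exact hdist n Q hQ P hP
    have := hL.hausdorffMeasure_image_le (zero_le_one (α := ℝ))
    rw [(hinj n).leftInvOn_invFunOn.image_image, ENNReal.rpow_one, hausdorffMeasure_real] at this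
    exact this
  have hfib : ∀ x, (f ⁻¹' {x} ∩ ⋃ n, A n).encard ≤ k := by
    intro x
    rw [hAu]
    refine (encard_le_encard (inter_subset_inter_right _ fun p hp => hp.1)).trans
      (hlines (f ⁻¹' {x}) ⟨1, 0, x, Or.inl one_ne_zero, ?_⟩ ⟨!₂[x, 0], ?_⟩)
    · ext p
      simp [f]
    · intro p hp
      have : p 0 = x := hp
      simp [rotConeAt, rotCone, this]
  have hsum := tsum_volume_image_le hf hAm hAd hinj hfib (measurableSet_Icc (a := (0 : ℝ)) (b := 1))
    (by
      rintro n _ ⟨⟨⟨t, ht, rfl⟩, -⟩, -⟩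
      exact (hsq t ht).1)
  calc Measure.hausdorffMeasure 1 G
      ≤ ∑' n, Measure.hausdorffMeasure 1 (A n) := hAu ▸ measure_iUnion_le A
    _ ≤ ∑' n, ENNReal.ofReal (Real.cos θ)⁻¹ * volume (f '' A n) := ENNReal.tsum_le_tsum hvol
    _ = ENNReal.ofReal (Real.cos θ)⁻¹ * ∑' n, volume (f '' A n) := ENNReal.tsum_mul_left
    _ ≤ ENNReal.ofReal (Real.cos θ)⁻¹ * k := by
        gcongr
        simpa using hsum
    _ = ENNReal.ofReal ((Real.cos θ)⁻¹ * k) := by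
        rw [ENNReal.ofReal_mul (by positivity), ENNReal.ofReal_natCast]
    _ ≤ ENNReal.ofReal (2 * k / Real.cos θ) := by
        refine ENNReal.ofReal_le_ofReal ?_
        rw [← div_eq_inv_mul]
        gcongr
        linarith [(Nat.cast_nonneg k : (0 : ℝ) ≤ k)]
end

section
/- Let γ : [0,1] → ℝ² be a continuous curve, and fix an integer k ≥ 2, an angle φ ∈ (0, π/2) and a rotation ρ ∈ [0, 2π). Suppose that every admissible line (every line contained in C_P(φ,ρ) for some point P ∈ ℝ²) intersects the image of γ in at most k points. Then the Hausdorff dimension of the image of γ is at most 1. -/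
open MeasureTheory Filter Set Topology Metric
open scoped ENNReal NNReal

/-- If the cardinality of every finite `ε`-separated subset of `s` is at most `C / ε`, for all
small `ε`, then `s` has Hausdorff dimension at most one. -/
lemma dimH_le_one_of_card_separated_mul_le {X : Type*} [EMetricSpace X] {s : Set X} {C δ : ℝ≥0}
    (hδ : 0 < δ)
    (h : ∀ ε : ℝ≥0, 0 < ε → ε < δ → ∀ S : Finset X, ↑S ⊆ s → IsSeparated ε (S : Set X) →
      S.card * ε ≤ C) :
    dimH s ≤ 1 := by
  borelize X
  have hpack : ∀ ε : ℝ≥0, 0 < ε → ε < δ → packingNumber ε s ≠ ⊤ := by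
    intro ε hε hεδ htop
    obtain ⟨n, hn⟩ := exists_nat_gt (C / ε)
    have hlt : (n : ℕ∞) < packingNumber ε s := htop ▸ ENat.natCast_lt_top n
    simp only [packingNumber, lt_iSup_iff] at hlt
    obtain ⟨D, hDs, hD, hnD⟩ := hlt
    obtain ⟨T, hTD, hT⟩ := exists_subset_encard_eq hnD.le
    have hTfin : T.Finite := finite_of_encard_eq_coe hT
    have hb := h ε hε hεδ hTfin.toFinset (by simpa using hTD.trans hDs)
      (by simpa using hD.subset hTD)
    rw [hTfin.encard_eq_coe_toFinset_card, Nat.cast_inj] at hT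
    rw [hT] at hb
    rw [div_lt_iff₀ hε] at hn
    exact hn.not_ge hb
  have hfin : ∀ ε : ℝ≥0, (maximalSeparatedSet ε s).Finite := fun ε ↦ by
    by_cases htop : packingNumber ε s = ⊤
    · simp [maximalSeparatedSet, htop]
    · exact encard_ne_top_iff.1 (encard_maximalSeparatedSet htop ▸ htop)
  have : ∀ ε : ℝ≥0, Fintype (maximalSeparatedSet ε s) := fun ε ↦ (hfin ε).fintype
  have hev : ∀ᶠ ε : ℝ≥0 in 𝓝[>] 0, 0 < ε ∧ ε < δ := Ioo_mem_nhdsGT hδ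
  have hdiam : ∀ (ε : ℝ≥0) (x : X), ediam (closedEBall x ε) ≤ 2 * ε :=
    fun ε x ↦ ediam_closedEBall_le
  have hle : μH[1] s ≤ liminf (fun ε : ℝ≥0 ↦
      ∑ i : maximalSeparatedSet ε s, ediam (closedEBall (i : X) ε) ^ (1 : ℝ)) (𝓝[>] 0) := by
    refine Measure.hausdorffMeasure_le_liminf_sum 1 s (fun ε : ℝ≥0 ↦ 2 * (ε : ℝ≥0∞)) ?_
      (fun ε (i : maximalSeparatedSet ε s) ↦ closedEBall (i : X) ε)
      (Eventually.of_forall fun ε i ↦ hdiam ε i) ?_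
    · have hc : Continuous fun ε : ℝ≥0 ↦ 2 * (ε : ℝ≥0∞) :=
        (ENNReal.continuous_const_mul (by simp)).comp ENNReal.continuous_coe
      simpa using (hc.tendsto 0).mono_left nhdsWithin_le_nhds
    · filter_upwards [hev] with ε hε x hx
      obtain ⟨y, hy, hxy⟩ := isCover_maximalSeparatedSet (hpack ε hε.1 hε.2) hx
      exact mem_iUnion.2 ⟨⟨y, hy⟩, hxy⟩
  have hbound : liminf (fun ε : ℝ≥0 ↦
      ∑ i : maximalSeparatedSet ε s, ediam (closedEBall (i : X) ε) ^ (1 : ℝ)) (𝓝[>] 0) ≤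
      2 * (C : ℝ≥0∞) := by
    refine liminf_le_of_frequently_le' (Eventually.frequently ?_)
    filter_upwards [hev] with ε hε
    have hb := h ε hε.1 hε.2 (hfin ε).toFinset (by simpa using maximalSeparatedSet_subset)
      (by simpa using isSeparated_maximalSeparatedSet)
    calc ∑ i : maximalSeparatedSet ε s, ediam (closedEBall (i : X) ε) ^ (1 : ℝ)
        ≤ ∑ i : maximalSeparatedSet ε s, 2 * (ε : ℝ≥0∞) :=
          Finset.sum_le_sum fun i _ ↦ by simpa using hdiam ε i
      _ = 2 * (((hfin ε).toFinset.card * ε : ℝ≥0) : ℝ≥0∞) := by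
          rw [Finset.sum_const, Finset.card_univ, nsmul_eq_mul,
            ← Set.toFinset_card, (hfin ε).toFinset_eq_toFinset]
          push_cast
          ring
      _ ≤ 2 * (C : ℝ≥0∞) := by gcongr
  refine dimH_le_of_hausdorffMeasure_ne_top (d := 1) ?_
  rw [NNReal.coe_one]
  exact ((hle.trans hbound).trans_lt (by finiteness)).ne

/-- If disjoint sets `A i` each have a trace on `E` whose image under `f` contains an interval of
length `r`, and the fibres of `f` on `E` have at most `k` points, then the number of
these sets is at most `k * (b - a) / r`, where `f` takes values in `[a, b]` on `E`. -/
lemma card_mul_le_of_encard_fiber_le {ι X : Type*} {E : Set X} {f : X → ℝ} {k : ℕ} {a b r : ℝ}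
    (hab : a ≤ b) (hf : ∀ x ∈ E, f x ∈ Icc a b)
    (hk : ∀ c, {x ∈ E | f x = c}.encard ≤ k) (S : Finset ι) (A : ι → Set X)
    (hA : (S : Set ι).PairwiseDisjoint A) (l : ι → ℝ)
    (hl : ∀ i ∈ S, Ioo (l i) (l i + r) ⊆ f '' (E ∩ A i)) :
    S.card * r ≤ k * (b - a) := by
  classical
  have hcount : ∀ c, (∑ i ∈ S, (Ioo (l i) (l i + r)).indicator (fun _ ↦ (1 : ℝ≥0∞)) c) ≤
      (Icc a b).indicator (fun _ ↦ (k : ℝ≥0∞)) c := by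
    intro c
    have hsum : (∑ i ∈ S, (Ioo (l i) (l i + r)).indicator (fun _ ↦ (1 : ℝ≥0∞)) c) =
        (S.filter fun i ↦ c ∈ Ioo (l i) (l i + r)).card := by
      simp [indicator_apply]
    rw [hsum]
    set T := S.filter fun i ↦ c ∈ Ioo (l i) (l i + r)
    have hpt : ∀ i : T, ∃ x, (x ∈ E ∧ f x = c) ∧ x ∈ A i := by
      rintro ⟨i, hi⟩
      obtain ⟨hiS, hic⟩ := Finset.mem_filter.1 hi
      obtain ⟨x, ⟨hxE, hxA⟩, hx⟩ := hl i hiS hic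
      exact ⟨x, ⟨hxE, hx⟩, hxA⟩
    choose g hg hgA using hpt
    by_cases hc : c ∈ Icc a b
    · rw [indicator_of_mem hc]
      have hinj : Function.Injective g := by
        intro i j hij
        by_contra hne
        exact (hA (Finset.mem_filter.1 i.2).1 (Finset.mem_filter.1 j.2).1
          (fun h ↦ hne (Subtype.ext h))).le_bot ⟨hgA i, hij ▸ hgA j⟩
      have hcard : (range g).encard ≤ k :=
        (encard_le_encard (range_subset_iff.2 hg)).trans (hk c)
      rw [← image_univ, hinj.encard_image, encard_univ, ENat.card_eq_coe_fintype_card,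
        Fintype.card_coe] at hcard
      exact_mod_cast hcard
    · have hT : T = ∅ := Finset.eq_empty_of_forall_notMem fun i hi ↦
        hc ((hg ⟨i, hi⟩).2 ▸ hf _ (hg ⟨i, hi⟩).1)
      simp [hT]
  have hint := lintegral_mono (μ := volume) hcount
  rw [lintegral_finsetSum _ fun i _ ↦ measurable_const.indicator measurableSet_Ioo,
    lintegral_indicator_const measurableSet_Icc] at hint
  simp only [lintegral_indicator_const measurableSet_Ioo, Real.volume_Ioo, Real.volume_Icc,
    add_sub_cancel_left, one_mul, Finset.sum_const, nsmul_eq_mul] at hint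
  rw [← ENNReal.ofReal_natCast, ← ENNReal.ofReal_natCast, ← ENNReal.ofReal_mul (by positivity),
    ← ENNReal.ofReal_mul (by positivity)] at hint
  exact (ENNReal.ofReal_le_ofReal_iff (mul_nonneg (by positivity) (sub_nonneg.2 hab))).1 hint

/-- A preconnected planar set through `x` that leaves the square of radius `r` about `x` has a
coordinate projection which, restricted to this square, contains an interval of length `r`. -/
lemma IsPreconnected.exists_Ioo_subset_image_inter_closedBall {E : Set (ℝ × ℝ)}
    (hE : IsPreconnected E) {x y : ℝ × ℝ} (hx : x ∈ E) (hy : y ∈ E) {r : ℝ}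
    (hxy : r < dist y x) :
    (∃ l, Ioo l (l + r) ⊆ Prod.fst '' (E ∩ closedBall x r)) ∨
      ∃ l, Ioo l (l + r) ⊆ Prod.snd '' (E ∩ closedBall x r) := by
  have hball : ∀ p : ℝ × ℝ, p ∈ closedBall x r ↔
      (x.1 - r ≤ p.1 ∧ p.1 ≤ x.1 + r) ∧ x.2 - r ≤ p.2 ∧ p.2 ≤ x.2 + r := by
    intro p
    rw [← closedBall_prod_same, Set.mem_prod, Real.closedBall_eq_Icc, Real.closedBall_eq_Icc]
    rfl
  by_contra! hcon
  obtain ⟨hfst, hsnd⟩ := hcon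
  simp only [not_subset, mem_Ioo, mem_image, mem_inter_iff, not_exists, not_and, hball] at hfst hsnd
  obtain ⟨b₁, hb₁, hB₁⟩ := hfst x.1
  obtain ⟨a₁, ha₁, hA₁⟩ := hfst (x.1 - r)
  obtain ⟨b₂, hb₂, hB₂⟩ := hsnd x.2
  obtain ⟨a₂, ha₂, hA₂⟩ := hsnd (x.2 - r)
  obtain ⟨p, hpE, hpU, hpV⟩ := hE (Ioo a₁ b₁ ×ˢ Ioo a₂ b₂) (Icc a₁ b₁ ×ˢ Icc a₂ b₂)ᶜ
    (isOpen_Ioo.prod isOpen_Ioo) (isClosed_Icc.prod isClosed_Icc).isOpen_compl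
    (by
      intro p hp
      by_contra hn
      simp only [mem_union, mem_prod, mem_Ioo, mem_compl_iff, mem_Icc, not_or, not_not] at hn
      obtain ⟨hno, ⟨h1, h2⟩, h3, h4⟩ := hn
      have hpb : (x.1 - r ≤ p.1 ∧ p.1 ≤ x.1 + r) ∧ x.2 - r ≤ p.2 ∧ p.2 ≤ x.2 + r :=
        ⟨⟨by linarith, by linarith⟩, by linarith, by linarith⟩
      exact hno ⟨⟨h1.lt_of_ne' (hA₁ p ⟨hp, hpb⟩), h2.lt_of_ne (hB₁ p ⟨hp, hpb⟩)⟩,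
        h3.lt_of_ne' (hA₂ p ⟨hp, hpb⟩), h4.lt_of_ne (hB₂ p ⟨hp, hpb⟩)⟩)
    ⟨x, hx, ⟨by linarith, by linarith⟩, by linarith, by linarith⟩
    ⟨y, hy, fun hyI ↦ by
      obtain ⟨⟨h1, h2⟩, h3, h4⟩ := hyI
      refine hxy.not_ge (mem_closedBall.1 ((hball y).2 ?_))
      exact ⟨⟨by linarith, by linarith⟩, by linarith, by linarith⟩⟩
  exact hpV (prod_mono Ioo_subset_Icc_self Ioo_subset_Icc_self hpU)

/-- A bounded connected planar set which meets every vertical and every horizontal line in at most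
`k` points has Hausdorff dimension at most one. -/
lemma IsPreconnected.dimH_le_one_of_encard_le {E : Set (ℝ × ℝ)} (hE : IsPreconnected E)
    (hEb : Bornology.IsBounded E) {k : ℕ} (h₁ : ∀ c, {x ∈ E | x.1 = c}.encard ≤ k)
    (h₂ : ∀ c, {x ∈ E | x.2 = c}.encard ≤ k) :
    dimH E ≤ 1 := by
  classical
  rcases E.subsingleton_or_nontrivial with hsub | hnt
  · simp [dimH_subsingleton hsub]
  obtain ⟨p, hp, q, hq, hpq⟩ := hnt
  have hd : 0 < dist p q := dist_pos.2 hpq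
  obtain ⟨M, hM⟩ := hEb.subset_closedBall 0
  have hM0 : 0 ≤ M := dist_nonneg.trans (hM hp)
  have hM₁ : ∀ x ∈ E, x.1 ∈ Icc (-M) M := fun x hx ↦ by
    have := (norm_fst_le x).trans (mem_closedBall_zero_iff.1 (hM hx))
    exact abs_le.1 this
  have hM₂ : ∀ x ∈ E, x.2 ∈ Icc (-M) M := fun x hx ↦ by
    have := (norm_snd_le x).trans (mem_closedBall_zero_iff.1 (hM hx))
    exact abs_le.1 this
  refine dimH_le_one_of_card_separated_mul_le (C := 8 * k * M.toNNReal) (δ := (dist p q).toNNReal)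
    (by simpa using hpq) fun ε hε hεd S hSE hS ↦ ?_
  obtain ⟨r, hr⟩ : ∃ r : ℝ, r = ε / 2 := ⟨_, rfl⟩
  have hεd' : (ε : ℝ) < dist p q := by
    rwa [Real.lt_toNNReal_iff_coe_lt] at hεd
  have hdisj : (S : Set (ℝ × ℝ)).PairwiseDisjoint fun x ↦ closedBall x r := by
    intro x hx y hy hxy
    have hlt : (ε : ℝ≥0∞) < edist x y := hS hx hy hxy
    rw [edist_nndist, ENNReal.coe_lt_coe, ← NNReal.coe_lt_coe, coe_nndist] at hlt
    exact closedBall_disjoint_closedBall (by linarith)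
  have hfar : ∀ x : ℝ × ℝ, ∃ y ∈ E, r < dist y x := by
    intro x
    by_contra! hcon
    have := dist_triangle_right p q x
    linarith [hcon p hp, hcon q hq]
  have halt := fun x (hx : x ∈ S) ↦ (hfar x).elim fun y hy ↦
    hE.exists_Ioo_subset_image_inter_closedBall (hSE hx) hy.1 hy.2
  let P : ℝ × ℝ → Prop := fun x ↦ ∃ l, Ioo l (l + r) ⊆ Prod.fst '' (E ∩ closedBall x r)
  have hP : ∀ x, ∃ l, P x → Ioo l (l + r) ⊆ Prod.fst '' (E ∩ closedBall x r) := fun x ↦ by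
    by_cases hx : P x
    · exact hx.imp fun l hl _ ↦ hl
    · exact ⟨0, fun h ↦ (hx h).elim⟩
  have hQ : ∀ x, ∃ l, x ∈ S → ¬ P x → Ioo l (l + r) ⊆ Prod.snd '' (E ∩ closedBall x r) := fun x ↦ by
    by_cases hx : x ∈ S ∧ ¬ P x
    · exact ((halt x hx.1).resolve_left hx.2).imp fun l hl _ _ ↦ hl
    · exact ⟨0, fun h h' ↦ (hx ⟨h, h'⟩).elim⟩
  choose l₁ hl₁ using hP
  choose l₂ hl₂ using hQ
  have hc₁ := card_mul_le_of_encard_fiber_le (by linarith) hM₁ h₁ (S.filter P) _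
    (hdisj.subset (Finset.coe_subset.2 (S.filter_subset _))) l₁ fun i hi ↦ hl₁ i (Finset.mem_filter.1 hi).2
  have hc₂ := card_mul_le_of_encard_fiber_le (by linarith) hM₂ h₂ (S.filter (¬ P ·)) _
    (hdisj.subset (Finset.coe_subset.2 (S.filter_subset _))) l₂ fun i hi ↦
      hl₂ i (Finset.mem_filter.1 hi).1 (Finset.mem_filter.1 hi).2
  have hcard : ((S.filter P).card : ℝ) + (S.filter (¬ P ·)).card = S.card := by
    exact_mod_cast S.card_filter_add_card_filter_not P
  rw [← NNReal.coe_le_coe]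
  push_cast
  rw [Real.coe_toNNReal _ hM0, ← hcard]
  rw [hr] at hc₁ hc₂
  linarith

/-- Under the hypothesis that every admissible line meets the
image of `γ` in at most `k` points, the image of `γ` has Hausdorff dimension
at most 1. -/
theorem stmt_9 (γ : ℝ → EuclideanSpace ℝ (Fin 2)) (hγ : ContinuousOn γ (Set.Icc 0 1))
    (k : ℕ) (hk : 2 ≤ k) (φ ρ : ℝ) (hφ : φ ∈ Set.Ioo 0 (Real.pi / 2))
    (hρ : ρ ∈ Set.Ico 0 (2 * Real.pi))
    (hlines : ∀ L : Set (EuclideanSpace ℝ (Fin 2)), IsLine L →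
      (∃ P : EuclideanSpace ℝ (Fin 2), L ⊆ rotConeAt P φ ρ) →
      (L ∩ γ '' Set.Icc 0 1).encard ≤ k) :
    dimH (γ '' Set.Icc 0 1) ≤ 1 := by
  have hτ : 0 < Real.tan φ := Real.tan_pos_of_pos_of_lt_pi_div_two hφ.1 hφ.2
  set τ := Real.tan φ with hτ_def
  set s := Real.sin ρ with hs
  set c := Real.cos ρ with hc
  have hsc : s ^ 2 + c ^ 2 = 1 := Real.sin_sq_add_cos_sq ρ
  have hfiber : ∀ a b : ℝ, (a ≠ 0 ∨ b ≠ 0) →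
      (∀ q : EuclideanSpace ℝ (Fin 2), a * q 0 + b * q 1 = 0 → q ∈ rotCone φ ρ) →
      ∀ d, ({p | a * p 0 + b * p 1 = d} ∩ γ '' Icc 0 1).encard ≤ k := by
    intro a b hab hcone d
    rcases eq_empty_or_nonempty {p : EuclideanSpace ℝ (Fin 2) | a * p 0 + b * p 1 = d} with h | h
    · simp [h]
    obtain ⟨P, hP⟩ := h
    refine hlines _ ⟨a, b, d, hab, rfl⟩ ⟨P, fun q hq ↦ hcone _ ?_⟩
    simp only [mem_ofPred_eq, PiLp.sub_apply] at hP hq ⊢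
    linear_combination hq - hP
  have hfiber₁ := hfiber c s (by
      by_contra! h
      simp [h.1, h.2] at hsc) fun q hq ↦ by
    simp only [rotCone, mem_ofPred_eq, ← hs, ← hc, hq, abs_zero, mul_zero]
    positivity
  have hfiber₂ := hfiber (τ * c + s) (τ * s - c) (by
      by_contra! h
      nlinarith [mul_self_eq_zero.2 h.1, mul_self_eq_zero.2 h.2, sq_nonneg τ]) fun q hq ↦ by
    have he : -s * q 0 + c * q 1 = τ * (c * q 0 + s * q 1) := by linear_combination -hq
    simp only [rotCone, mem_ofPred_eq, ← hs, ← hc, ← hτ_def, he, abs_mul, abs_of_pos hτ, le_refl]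
  let T : EuclideanSpace ℝ (Fin 2) →ₗ[ℝ] ℝ × ℝ :=
    { toFun := fun p ↦ (c * p 0 + s * p 1, (τ * c + s) * p 0 + (τ * s - c) * p 1)
      map_add' := fun p q ↦ by ext <;> simp <;> ring
      map_smul' := fun t p ↦ by ext <;> simp <;> ring }
  have hT : ∀ p, T p = (c * p 0 + s * p 1, (τ * c + s) * p 0 + (τ * s - c) * p 1) := fun _ ↦ rfl
  have hker : T.ker = ⊥ := by
    refine LinearMap.ker_eq_bot'.2 fun p hp ↦ ?_
    rw [hT, Prod.mk_eq_zero] at hp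
    ext i
    fin_cases i
    · change p 0 = 0
      linear_combination (-(p 0)) * hsc + (c + τ * (-s)) * hp.1 + s * hp.2
    · change p 1 = 0
      linear_combination (-(p 1)) * hsc + (s + τ * c) * hp.1 - c * hp.2
  obtain ⟨K, -, hK⟩ := T.exists_antilipschitzWith hker
  have hcont : ContinuousOn (T ∘ γ) (Icc 0 1) :=
    T.continuous_of_finiteDimensional.comp_continuousOn hγ
  have hcard : ∀ g : ℝ × ℝ → ℝ, ∀ d, ({p | g (T p) = d} ∩ γ '' Icc 0 1).encard ≤ k →
      {x ∈ T '' (γ '' Icc 0 1) | g x = d}.encard ≤ k := by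
    intro g d h
    refine (encard_le_encard ?_).trans ((encard_image_le T _).trans h)
    rintro _ ⟨⟨p, hp, rfl⟩, hd⟩
    exact ⟨p, ⟨hd, hp⟩, rfl⟩
  refine (hK.le_dimH_image _).trans (IsPreconnected.dimH_le_one_of_encard_le (k := k) ?_ ?_
    (fun d ↦ hcard Prod.fst d (hfiber₁ d)) fun d ↦ hcard Prod.snd d (hfiber₂ d))
  · rw [← image_comp]
    exact isPreconnected_Icc.image _ hcont
  · rw [← image_comp]
    exact (isCompact_Icc.image_of_continuousOn hcont).isBounded
end

section
/- For every λ > 0 there exists a continuous function f : [0,1] → ℝ such that every λ-admissible line in ℝ² (i.e. every line that is vertical or whose slope μ satisfies |μ| ≥ λ) intersects the graph of f in at most three points, yet f is not Lipschitz on any neighborhood of the point 1/2; in particular, f is not locally Lipschitz. -/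
/-- The cubing map on `ℝ` as an order isomorphism; its inverse is the real cube root. -/
noncomputable def cubeOrderIso : ℝ ≃o ℝ :=
  StrictMono.orderIsoOfSurjective (fun s : ℝ => s ^ 3) (Odd.strictMono_pow (by decide))
    ((continuous_pow 3).surjective (Filter.tendsto_pow_atTop (by norm_num)) (by
      have h := Filter.tendsto_neg_atTop_atBot.comp
        ((Filter.tendsto_pow_atTop (α := ℝ) (n := 3) (by norm_num)).comp
          Filter.tendsto_neg_atBot_atTop)
      refine h.congr fun s => ?_
      simp only [Function.comp_apply]
      ring))

lemma cubeOrderIso_symm_pow (x : ℝ) : cubeOrderIso.symm x ^ 3 = x :=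
  cubeOrderIso.apply_symm_apply x

lemma cubeOrderIso_symm_cube (s : ℝ) : cubeOrderIso.symm (s ^ 3) = s :=
  cubeOrderIso.symm_apply_apply s

/-- A depressed cubic equation with nonzero linear term has at most three solutions. -/
lemma encard_cubic_solutions_le (a b : ℝ) : {s : ℝ | s = a * s ^ 3 + b}.encard ≤ 3 := by
  open Polynomial in
  let p : ℝ[X] := C a * X ^ 3 - X + C b
  have hdeg : p.natDegree ≤ 3 := by
    dsimp only [p]
    compute_degree
  have hp : p ≠ 0 := by
    intro h
    have h1 : p.coeff 1 = 0 := by rw [h, Polynomial.coeff_zero]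
    simp [p, Polynomial.coeff_X] at h1
  have hsub : {s : ℝ | s = a * s ^ 3 + b} ⊆ (p.roots.toFinset : Set ℝ) := by
    intro s hs
    have hs : s = a * s ^ 3 + b := hs
    simp only [Finset.mem_coe, Multiset.mem_toFinset, Polynomial.mem_roots hp,
      Polynomial.IsRoot.def]
    simp only [p, Polynomial.eval_add, Polynomial.eval_sub, Polynomial.eval_mul,
      Polynomial.eval_C, Polynomial.eval_pow, Polynomial.eval_X]
    linarith
  refine (Set.encard_le_encard hsub).trans ?_
  rw [Set.encard_coe_eq_coe_finsetCard]
  exact_mod_cast (Multiset.toFinset_card_le _).trans (p.card_roots'.trans hdeg)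


/-- For every `λ > 0` there is a continuous `f : [0,1] → ℝ` such
that every λ-admissible line (vertical, or of slope `μ` with `|μ| ≥ λ`) meets
the graph of `f` in at most three points, yet `f` is not Lipschitz on any
neighborhood of `1/2`. -/
theorem stmt_11 (lam : ℝ) (hlam : 0 < lam) :
    ∃ f : ℝ → ℝ, ContinuousOn f (Set.Icc 0 1) ∧
      (∀ L : Set (ℝ × ℝ),
        ((∃ c : ℝ, L = {p : ℝ × ℝ | p.1 = c}) ∨
          (∃ μ c : ℝ, lam ≤ |μ| ∧ L = {p : ℝ × ℝ | p.2 = μ * p.1 + c})) →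
        (L ∩ {p : ℝ × ℝ | p.1 ∈ Set.Icc (0 : ℝ) 1 ∧ p.2 = f p.1}).encard ≤ 3) ∧
      ∀ U ∈ nhds (1 / 2 : ℝ),
        ¬ ∃ K : NNReal, LipschitzOnWith K f (U ∩ Set.Icc 0 1) := by
  refine ⟨fun x => cubeOrderIso.symm (x - 1 / 2), ?_, ?_, ?_⟩
  · exact (cubeOrderIso.symm.continuous.comp (continuous_id.sub continuous_const)).continuousOn
  · rintro L (⟨c, rfl⟩ | ⟨μ, c, -, rfl⟩)
    · refine le_trans (Set.encard_le_one_iff.2 ?_) (by norm_num)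
      rintro ⟨x, y⟩ ⟨x', y'⟩ ⟨hx, -, hy⟩ ⟨hx', -, hy'⟩
      simp only [Set.mem_ofPred_eq] at hx hx' hy hy'
      simp [hx, hx', hy, hy']
    · have hcube : ∀ {x y : ℝ}, y = cubeOrderIso.symm (x - 1 / 2) → x = y ^ 3 + 1 / 2 := by
        rintro x y rfl
        rw [cubeOrderIso_symm_pow]
        ring
      refine (Set.encard_le_encard_of_injOn (f := Prod.snd) ?_ ?_).trans
        (encard_cubic_solutions_le μ (μ / 2 + c))
      · rintro ⟨x, y⟩ ⟨hline, -, hgraph⟩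
        have hline : y = μ * x + c := hline
        have hx : x = y ^ 3 + 1 / 2 := hcube hgraph
        rw [hx] at hline
        change y = μ * y ^ 3 + (μ / 2 + c)
        linarith
      · rintro ⟨x, y⟩ ⟨-, -, h⟩ ⟨x', y'⟩ ⟨-, -, h'⟩ (rfl : y = y')
        exact Prod.ext ((hcube h).trans (hcube h').symm) rfl
  · rintro U hU ⟨K, hK⟩
    have hcont : Filter.Tendsto (fun d : ℝ => 1 / 2 + d ^ 3) (nhds 0) (nhds (1 / 2)) :=
      Continuous.tendsto' (by fun_prop) _ _ (by norm_num)
    have hsmall : ∀ᶠ d : ℝ in nhds 0, K * d ^ 2 < 1 :=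
      (Continuous.tendsto' (f := fun d : ℝ => (K : ℝ) * d ^ 2) (by fun_prop) 0 0
        (by norm_num)).eventually_lt_const one_pos
    have hIcc : Set.Icc (0 : ℝ) 1 ∈ nhds (1 / 2 : ℝ) :=
      Icc_mem_nhds (by norm_num) (by norm_num)
    have hmem := hcont.eventually (Filter.inter_mem hU hIcc)
    obtain ⟨d, ⟨hd, hd'⟩, hpos⟩ :=
      (((hmem.and hsmall).filter_mono nhdsWithin_le_nhds).and
        (self_mem_nhdsWithin (s := Set.Ioi (0 : ℝ)))).exists
    have hpos : 0 < d := hpos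
    have hlip := hK.dist_le_mul _ hd _ (mem_of_mem_nhds (Filter.inter_mem hU hIcc))
    have hzero : cubeOrderIso.symm 0 = 0 := by
      simpa using cubeOrderIso_symm_cube 0
    simp only [Real.dist_eq, add_sub_cancel_left, sub_self, cubeOrderIso_symm_cube, hzero,
      sub_zero, abs_of_pos hpos, abs_of_pos (pow_pos hpos 3)] at hlip
    nlinarith
end

section
/- Let λ > 0 and let f : (0,1) → ℝ be a continuous function such that every λ-admissible line in ℝ² (i.e. every line that is vertical or whose slope μ satisfies |μ| ≥ λ) intersects the graph of f in at most two points. Suppose x₀ < y₀ in (0,1) are such that λ′ := (f(y₀) − f(x₀))/(y₀ − x₀) satisfies λ′ ≥ λ, and suppose that f(y) − λ′·y < f(x₀) − λ′·x₀ for all y ∈ (x₀, y₀). Then f(y) − λ′·y > f(x₀) − λ′·x₀ for all y ∈ (y₀, 1). -/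
/-- Let `f : (0,1) → ℝ` be continuous with every λ-admissible
line meeting its graph in at most two points. If `x₀ < y₀` in `(0,1)`,
`λ' = (f y₀ − f x₀)/(y₀ − x₀) ≥ λ`, and `f y − λ'y < f x₀ − λ'x₀` for all
`y ∈ (x₀, y₀)`, then `f y − λ'y > f x₀ − λ'x₀` for all `y ∈ (y₀, 1)`. -/
theorem stmt_15 (lam : ℝ) (hlam : 0 < lam) (f : ℝ → ℝ)
    (hf : ContinuousOn f (Set.Ioo 0 1))
    (hlines : ∀ L : Set (ℝ × ℝ),
      ((∃ c : ℝ, L = {p : ℝ × ℝ | p.1 = c}) ∨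
        (∃ μ c : ℝ, lam ≤ |μ| ∧ L = {p : ℝ × ℝ | p.2 = μ * p.1 + c})) →
      (L ∩ {p : ℝ × ℝ | p.1 ∈ Set.Ioo (0 : ℝ) 1 ∧ p.2 = f p.1}).encard ≤ 2)
    (x₀ y₀ : ℝ) (hx₀ : x₀ ∈ Set.Ioo (0 : ℝ) 1) (hy₀ : y₀ ∈ Set.Ioo (0 : ℝ) 1)
    (hxy : x₀ < y₀) (lam' : ℝ) (hlam' : lam' = (f y₀ - f x₀) / (y₀ - x₀))
    (hge : lam ≤ lam')
    (hbelow : ∀ y ∈ Set.Ioo x₀ y₀, f y - lam' * y < f x₀ - lam' * x₀) :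
    ∀ y ∈ Set.Ioo y₀ 1, f x₀ - lam' * x₀ < f y - lam' * y := by
  set φ : ℝ → ℝ := fun x => f x - lam' * x with hφ
  have hcont : ContinuousOn φ (Set.Ioo 0 1) := hf.sub (by fun_prop)
  have not_three : ∀ a b d : ℝ, 0 < a → a < b → b < d → d < 1 →
      φ a = φ b → φ d = φ b → False := by
    intro a b d ha hab hbd hd h₁ h₂
    simp only [hφ] at h₁ h₂
    have hL := hlines _ (Or.inr ⟨lam', φ b, hge.trans (le_abs_self _), rfl⟩)
    have hsub : ({(a, f a), (b, f b), (d, f d)} : Set (ℝ × ℝ)) ⊆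
        {p : ℝ × ℝ | p.2 = lam' * p.1 + φ b} ∩
          {p : ℝ × ℝ | p.1 ∈ Set.Ioo (0 : ℝ) 1 ∧ p.2 = f p.1} := by
      rintro p (rfl | rfl | rfl) <;>
        refine ⟨?_, ⟨?_, ?_⟩, rfl⟩ <;> simp only [hφ, Set.mem_ofPred_eq] <;> linarith
    have hcard : ({(a, f a), (b, f b), (d, f d)} : Set (ℝ × ℝ)).encard = 3 :=
      Set.encard_eq_three.mpr ⟨_, _, _, by simp [hab.ne], by simp [(hab.trans hbd).ne],
        by simp [hbd.ne], rfl⟩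
    have := (Set.encard_le_encard hsub).trans hL
    rw [hcard] at this
    exact absurd this (by decide)
  have hends : φ y₀ = φ x₀ := by
    have h : y₀ - x₀ ≠ 0 := (sub_pos.mpr hxy).ne'
    rw [eq_div_iff h] at hlam'
    simp only [hφ]
    linarith
  obtain ⟨hx0, hx1⟩ := hx₀
  obtain ⟨hy0, hy1⟩ := hy₀
  rintro y ⟨hy₀y, hy⟩
  by_contra! hle
  change φ y ≤ φ x₀ at hle
  rcases hle.eq_or_lt with heq | hlt
  · exact not_three x₀ y₀ y hx0 hxy hy₀y hy hends.symm (heq.trans hends.symm)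
  obtain ⟨m, hxm, hmy⟩ := exists_between hxy
  have hm : φ m < φ x₀ := hbelow m ⟨hxm, hmy⟩
  obtain ⟨c, hc, hcx⟩ := exists_between (max_lt hm hlt)
  obtain ⟨hmc, hyc⟩ := max_lt_iff.mp hc
  have hcy : c < φ y₀ := hends ▸ hcx
  obtain ⟨a, ⟨hxa, ham⟩, ha⟩ := intermediate_value_Ioo' hxm.le
    (hcont.mono fun t ht => ⟨by linarith [ht.1], by linarith [ht.2]⟩) ⟨hmc, hcx⟩
  obtain ⟨b, ⟨hmb, hby⟩, hb⟩ := intermediate_value_Ioo hmy.le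
    (hcont.mono fun t ht => ⟨by linarith [ht.1], by linarith [ht.2]⟩) ⟨hmc, hcy⟩
  obtain ⟨d, ⟨hyd, hdy⟩, hd⟩ := intermediate_value_Ioo' hy₀y.le
    (hcont.mono fun t ht => ⟨by linarith [ht.1], by linarith [ht.2]⟩) ⟨hyc, hcy⟩
  exact not_three a b d (hx0.trans hxa) (ham.trans hmb) (hby.trans hyd) (hdy.trans hy)
    (ha.trans hb.symm) (hd.trans hb.symm)
end
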